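/- arXiv:2103.04575 — 6 statements merged into one kernel-verified Lean document; each statement's English description precedes it below -/
import Mathlib

section
/- Let K₁ and K₂ be fields. If the Laurent polynomial rings K₁[t,t⁻¹] and K₂[t,t⁻¹] are elementarily equivalent as rings, then the fields K₁ and K₂ are elementarily equivalent. -/
open FirstOrder Language FirstOrder.Ring LaurentPolynomial

namespace FirstOrder.Language

variable {L : Language} {α : Type*}

/-- Relativization of a formula to the definable set cut out by a formula `δ` in one variable. -/
def BoundedFormula.relativize (δ : L.Formula Unit) :
    ∀ {n : ℕ}, L.BoundedFormula α n → L.BoundedFormula α n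
  | _, .falsum => .falsum
  | _, .equal t₁ t₂ => .equal t₁ t₂
  | _, .rel R ts => .rel R ts
  | _, .imp φ ψ => (relativize δ φ).imp (relativize δ ψ)
  | n, .all φ =>
    ((BoundedFormula.relabel (fun _ => Sum.inr (Fin.last n)) δ :
      L.BoundedFormula α (n + 1)).imp (relativize δ φ)).all

/-- If `δ` defines the range of an embedding `f`, then relativizing to `δ` computes truth in the
domain of `f`. -/
theorem BoundedFormula.realize_relativize {M N : Type*} [L.Structure M] [L.Structure N]
    (δ : L.Formula Unit) (f : M ↪[L] N)
    (hδ : ∀ x : N, δ.Realize (fun _ => x) ↔ x ∈ Set.range f)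
    {n : ℕ} (φ : L.BoundedFormula α n) (v : α → M) (xs : Fin n → M) :
    (BoundedFormula.relativize δ φ).Realize (f ∘ v) (f ∘ xs) ↔ φ.Realize v xs := by
  induction φ with
  | falsum => rfl
  | equal t₁ t₂ =>
    exact (BoundedFormula.IsAtomic.equal t₁ t₂).isQF.realize_embedding f
  | rel R ts =>
    exact (BoundedFormula.IsAtomic.rel R ts).isQF.realize_embedding f
  | imp φ ψ ihφ ihψ => simp only [relativize, realize_imp, ihφ, ihψ]
  | @all n φ ih =>
    have key (x : N) : (BoundedFormula.relabel (fun _ => Sum.inr (Fin.last n)) δ :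
        L.BoundedFormula α (n + 1)).Realize (f ∘ v) (Fin.snoc (f ∘ xs) x) ↔ x ∈ Set.range f := by
      rw [← hδ, Formula.Realize, BoundedFormula.realize_relabel]
      refine iff_of_eq (congrArg₂ _ ?_ (Subsingleton.elim _ _))
      funext
      simp
    simp only [relativize, realize_all, realize_imp]
    constructor
    · intro h a
      rw [← ih, Fin.comp_snoc]
      exact h (f a) ((key _).2 ⟨a, rfl⟩)
    · intro h x hx
      obtain ⟨a, rfl⟩ := (key x).1 hx
      rw [← Fin.comp_snoc]
      exact (ih _).2 (h a)

/-- If `δ` defines the range of an embedding `M ↪[L] N`, then `N` satisfies the relativization of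
a sentence to `δ` exactly when `M` satisfies the sentence. -/
theorem Sentence.realize_relativize {M N : Type*} [L.Structure M] [L.Structure N]
    (δ : L.Formula Unit) (f : M ↪[L] N)
    (hδ : ∀ x : N, δ.Realize (fun _ => x) ↔ x ∈ Set.range f) (φ : L.Sentence) :
    Sentence.Realize N (BoundedFormula.relativize δ φ) ↔ Sentence.Realize M φ := by
  rw [Sentence.Realize, Sentence.Realize, Formula.Realize, Formula.Realize,
    ← BoundedFormula.realize_relativize δ f hδ]
  exact iff_of_eq (congrArg₂ _ (Subsingleton.elim _ _) (Subsingleton.elim _ _))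

/-- Elementary equivalence descends to substructures uniformly defined by one formula. -/
theorem ElementarilyEquivalent.of_definable_range {M₁ M₂ N₁ N₂ : Type*} [L.Structure M₁]
    [L.Structure M₂] [L.Structure N₁] [L.Structure N₂] (δ : L.Formula Unit)
    (f₁ : M₁ ↪[L] N₁) (hf₁ : ∀ x : N₁, δ.Realize (fun _ => x) ↔ x ∈ Set.range f₁)
    (f₂ : M₂ ↪[L] N₂) (hf₂ : ∀ x : N₂, δ.Realize (fun _ => x) ↔ x ∈ Set.range f₂)
    (h : N₁ ≅[L] N₂) : M₁ ≅[L] M₂ := by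
  rw [elementarilyEquivalent_iff] at h ⊢
  intro φ
  rw [← Sentence.realize_relativize δ f₁ hf₁, ← Sentence.realize_relativize δ f₂ hf₂]
  exact h _

end FirstOrder.Language

namespace FirstOrder.Ring

/-- An injective ring homomorphism is an embedding in the language of rings. -/
def embeddingOfInjective {R S : Type*} [NonAssocRing R] [NonAssocRing S]
    [CompatibleRing R] [CompatibleRing S] (f : R →+* S) (hf : Function.Injective f) :
    R ↪[Language.ring] S where
  toFun := f
  inj' := hf
  map_fun' := fun {n} g => by cases g <;> simp
  map_rel' := fun {n} g => by cases g

/-- The formula saying that a term is zero or a unit. -/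
def zeroOrUnit (t : Language.ring.Term (Unit ⊕ Fin 1)) : Language.ring.Formula Unit :=
  ∃' (BoundedFormula.equal t 0 ⊔ BoundedFormula.equal (t * Term.var (Sum.inr 0)) 1)

/-- The formula saying that both `x` and `x + 1` are zero or a unit. -/
def zeroOrUnitPair : Language.ring.Formula Unit :=
  zeroOrUnit (Term.var (Sum.inl ())) ⊓ zeroOrUnit (Term.var (Sum.inl ()) + 1)

theorem realize_zeroOrUnitPair {R : Type*} [CommRing R] [CompatibleRing R] (x : R) :
    zeroOrUnitPair.Realize (fun _ => x) ↔ (x = 0 ∨ IsUnit x) ∧ (x + 1 = 0 ∨ IsUnit (x + 1)) := by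
  have realize_equal {n : ℕ} (t₁ t₂ : Language.ring.Term (Unit ⊕ Fin n)) (v : Unit → R)
      (xs : Fin n → R) : (BoundedFormula.equal t₁ t₂).Realize v xs ↔
        t₁.realize (Sum.elim v xs) = t₂.realize (Sum.elim v xs) := Iff.rfl
  simp [zeroOrUnitPair, zeroOrUnit, Formula.Realize, realize_equal, isUnit_iff_exists_inv,
    exists_or, Fin.snoc]

end FirstOrder.Ring

namespace LaurentPolynomial

variable {K : Type*} [Field K]

theorem exists_eq_C_mul_T_of_isUnit {f : K[T;T⁻¹]} (hf : IsUnit f) :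
    ∃ (c : K) (n : ℤ), c ≠ 0 ∧ f = C c * T n := by
  obtain ⟨g, hg⟩ := hf.exists_right_inv
  obtain ⟨m, p, hp⟩ := exists_T_pow f
  obtain ⟨n, q, hq⟩ := exists_T_pow g
  have hpq : p * q = Polynomial.X ^ (m + n) := by
    apply Polynomial.toLaurent_injective
    rw [map_mul, hp, hq, Polynomial.toLaurent_X_pow, Nat.cast_add, T_add]
    linear_combination (T m * T n : K[T;T⁻¹]) * hg
  obtain ⟨i, -, u, hu⟩ := (dvd_prime_pow Polynomial.prime_X _).1 (Dvd.intro _ hpq)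
  obtain ⟨c, hc, hcu⟩ := Polynomial.isUnit_iff.1 (u⁻¹).isUnit
  have hpc : p = Polynomial.C c * Polynomial.X ^ i := by
    rw [hcu, ← hu, mul_comm, mul_assoc, Units.mul_inv, mul_one]
  refine ⟨c, i - m, hc.ne_zero, ?_⟩
  have h := congrArg (· * T (-m : ℤ)) hp
  simp only [hpc, Polynomial.toLaurent_C_mul_X_pow, mul_T_assoc, add_neg_cancel, T_zero,
    mul_one] at h
  rw [← h, sub_eq_add_neg]

theorem mem_range_C_iff (f : K[T;T⁻¹]) :
    f ∈ Set.range (C : K →+* K[T;T⁻¹]) ↔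
      (f = 0 ∨ IsUnit f) ∧ (f + 1 = 0 ∨ IsUnit (f + 1)) := by
  constructor
  · rintro ⟨a, rfl⟩
    have key (a : K) : C a = 0 ∨ IsUnit (C a) :=
      (eq_or_ne a 0).imp (fun h => by rw [h, map_zero]) fun h => h.isUnit.map C
    exact ⟨key a, by simpa using key (a + 1)⟩
  · rintro ⟨rfl | hf, hf1⟩
    · exact ⟨0, map_zero _⟩
    rcases hf1 with h0 | hf1
    · exact ⟨-1, by rw [map_neg, map_one, eq_neg_of_add_eq_zero_left h0]⟩
    obtain ⟨c, n, hc, rfl⟩ := exists_eq_C_mul_T_of_isUnit hf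
    obtain ⟨d, m, hd, h⟩ := exists_eq_C_mul_T_of_isUnit hf1
    rcases eq_or_ne n 0 with rfl | hn
    · exact ⟨c, by simp⟩
    rw [← single_zero_one_eq_one, ← single_eq_C_mul_T, ← single_eq_C_mul_T] at h
    have h0 := congrArg (fun p : K[T;T⁻¹] => p.coeff 0) h
    have hn' := congrArg (fun p : K[T;T⁻¹] => p.coeff n) h
    simp only [AddMonoidAlgebra.coeff_add, AddMonoidAlgebra.coeff_single, Finsupp.add_apply,
      Finsupp.single_apply] at h0 hn'
    grind

theorem C_injective : Function.Injective (C : K →+* K[T;T⁻¹]) := fun a b h => by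
  simpa using congrArg (fun p : K[T;T⁻¹] => p.coeff 0) h

end LaurentPolynomial

/-- If the Laurent polynomial rings `K₁[t,t⁻¹]` and `K₂[t,t⁻¹]` over fields `K₁`, `K₂`
are elementarily equivalent as rings (structures for the first-order language of rings),
then the fields `K₁` and `K₂` are elementarily equivalent. -/
theorem laurent_elementarilyEquivalent_implies_field_elementarilyEquivalent
    (K₁ K₂ : Type*) [Field K₁] [Field K₂] :
    letI := compatibleRingOfRing K₁[T;T⁻¹]
    letI := compatibleRingOfRing K₂[T;T⁻¹]
    letI := compatibleRingOfRing K₁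
    letI := compatibleRingOfRing K₂
    (K₁[T;T⁻¹] ≅[Language.ring] K₂[T;T⁻¹]) → (K₁ ≅[Language.ring] K₂) := by
  let := compatibleRingOfRing K₁[T;T⁻¹]
  let := compatibleRingOfRing K₂[T;T⁻¹]
  let := compatibleRingOfRing K₁
  let := compatibleRingOfRing K₂
  exact ElementarilyEquivalent.of_definable_range zeroOrUnitPair
    (embeddingOfInjective C C_injective)
    (fun x => (realize_zeroOrUnitPair x).trans (mem_range_C_iff x).symm)
    (embeddingOfInjective C C_injective)
    (fun x => (realize_zeroOrUnitPair x).trans (mem_range_C_iff x).symm)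
end

section
/- Let K₁ and K₂ be algebraically closed fields of characteristic zero. Then the Laurent polynomial rings K₁[t,t⁻¹] and K₂[t,t⁻¹] are elementarily equivalent as rings if and only if the transcendence degrees of K₁ and K₂ over ℚ are either both infinite, or both finite and equal. -/
open FirstOrder Language FirstOrder.Ring LaurentPolynomial Cardinal

/-- The transcendence degree of a field `K` of characteristic zero over its prime
subfield `ℚ`: the supremum of the cardinalities of the `ℚ`-algebraically independent
subsets of `K` (this equals the cardinality of any transcendence basis of `K` over `ℚ`). -/
noncomputable def trdegQ (K : Type*) [Field K] [CharZero K] : Cardinal :=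
  ⨆ s : {s : Set K // AlgebraicIndependent ℚ ((↑) : s → K)}, Cardinal.mk s.1

universe u

/-! ### Uniformly definable predicates on commutative rings -/

/-- A predicate on tuples from commutative rings, indexed by `Γ`, that is defined in all rings by
one first-order formula. -/
def UniformlyDefinable (Γ : Type) (P : ∀ (R : Type u) [CommRing R], (Γ → R) → Prop) : Prop :=
  ∃ φ : Language.ring.Formula Γ, ∀ (R : Type u) [CommRing R] [CompatibleRing R] (v : Γ → R),
    φ.Realize v ↔ P R v

/-- A function of tuples from commutative rings, indexed by `Γ`, that is given in all rings by
one term. -/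
def UniformlyTerm (Γ : Type) (t : ∀ (R : Type u) [CommRing R], (Γ → R) → R) : Prop :=
  ∃ s : Language.ring.Term Γ, ∀ (R : Type u) [CommRing R] [CompatibleRing R] (v : Γ → R),
    s.realize v = t R v

namespace UniformlyTerm

variable {Γ : Type} {s t : ∀ (R : Type u) [CommRing R], (Γ → R) → R}

theorem var (i : Γ) : UniformlyTerm.{u} Γ fun _ _ v => v i :=
  ⟨Term.var i, fun _ _ _ _ => rfl⟩

theorem zero : UniformlyTerm.{u} Γ fun _ _ _ => 0 :=
  ⟨0, fun _ _ _ _ => realize_zero _⟩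

theorem one : UniformlyTerm.{u} Γ fun _ _ _ => 1 :=
  ⟨1, fun _ _ _ _ => realize_one _⟩

theorem add (hs : UniformlyTerm Γ s) (ht : UniformlyTerm Γ t) :
    UniformlyTerm Γ fun R _ v => s R v + t R v := by
  obtain ⟨a, ha⟩ := hs
  obtain ⟨b, hb⟩ := ht
  exact ⟨a + b, fun R _ _ v => by rw [realize_add, ha, hb]⟩

theorem mul (hs : UniformlyTerm Γ s) (ht : UniformlyTerm Γ t) :
    UniformlyTerm Γ fun R _ v => s R v * t R v := by
  obtain ⟨a, ha⟩ := hs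
  obtain ⟨b, hb⟩ := ht
  exact ⟨a * b, fun R _ _ v => by rw [realize_mul, ha, hb]⟩

theorem neg (hs : UniformlyTerm Γ s) : UniformlyTerm Γ fun R _ v => -s R v := by
  obtain ⟨a, ha⟩ := hs
  exact ⟨-a, fun R _ _ v => by rw [realize_neg, ha]⟩

theorem sub (hs : UniformlyTerm Γ s) (ht : UniformlyTerm Γ t) :
    UniformlyTerm Γ fun R _ v => s R v - t R v := by
  simpa only [sub_eq_add_neg] using hs.add ht.neg

theorem pow (hs : UniformlyTerm Γ s) : ∀ n : ℕ, UniformlyTerm Γ fun R _ v => s R v ^ n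
  | 0 => by simpa only [pow_zero] using one
  | n + 1 => by simpa only [pow_succ] using (hs.pow n).mul hs

theorem relabel {Δ : Type} (hs : UniformlyTerm Γ s) (ρ : Γ → Δ) :
    UniformlyTerm Δ fun R _ v => s R fun i => v (ρ i) := by
  obtain ⟨a, ha⟩ := hs
  exact ⟨a.relabel ρ, fun R _ _ v => by rw [Term.realize_relabel, ha]; rfl⟩

theorem weaken (hs : UniformlyTerm Γ s) :
    UniformlyTerm (Option Γ) fun R _ v => s R fun i => v (some i) :=
  hs.relabel some

end UniformlyTerm

/-- A list of functions given by terms. -/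
inductive UniformlyTermList (Γ : Type) : (∀ (R : Type u) [CommRing R], (Γ → R) → List R) → Prop
  | nil : UniformlyTermList Γ fun _ _ _ => []
  | cons {t l} : UniformlyTerm Γ t → UniformlyTermList Γ l →
      UniformlyTermList Γ fun R _ v => t R v :: l R v

theorem UniformlyTermList.weaken {Γ : Type} {l : ∀ (R : Type u) [CommRing R], (Γ → R) → List R}
    (hl : UniformlyTermList Γ l) :
    UniformlyTermList (Option Γ) fun R _ v => l R fun i => v (some i) := by
  induction hl with
  | nil => exact .nil
  | cons ht _ ih => exact .cons ht.weaken ih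

namespace UniformlyDefinable

variable {Γ : Type} {P Q : ∀ (R : Type u) [CommRing R], (Γ → R) → Prop}
  {s t : ∀ (R : Type u) [CommRing R], (Γ → R) → R}

theorem eq (hs : UniformlyTerm Γ s) (ht : UniformlyTerm Γ t) :
    UniformlyDefinable Γ fun R _ v => s R v = t R v := by
  obtain ⟨a, ha⟩ := hs
  obtain ⟨b, hb⟩ := ht
  exact ⟨a.equal b, fun R _ _ v => by rw [Formula.realize_equal, ha, hb]⟩

theorem true : UniformlyDefinable.{u} Γ fun _ _ _ => True :=
  ⟨⊤, fun _ _ _ _ => by simp⟩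

theorem not (hP : UniformlyDefinable Γ P) : UniformlyDefinable Γ fun R _ v => ¬ P R v := by
  obtain ⟨φ, hφ⟩ := hP
  exact ⟨φ.not, fun R _ _ v => by rw [Formula.realize_not, hφ]⟩

theorem and (hP : UniformlyDefinable Γ P) (hQ : UniformlyDefinable Γ Q) :
    UniformlyDefinable Γ fun R _ v => P R v ∧ Q R v := by
  obtain ⟨φ, hφ⟩ := hP
  obtain ⟨ψ, hψ⟩ := hQ
  exact ⟨φ ⊓ ψ, fun R _ _ v => by rw [Formula.realize_inf, hφ, hψ]⟩

theorem or (hP : UniformlyDefinable Γ P) (hQ : UniformlyDefinable Γ Q) :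
    UniformlyDefinable Γ fun R _ v => P R v ∨ Q R v := by
  obtain ⟨φ, hφ⟩ := hP
  obtain ⟨ψ, hψ⟩ := hQ
  exact ⟨φ ⊔ ψ, fun R _ _ v => by rw [Formula.realize_sup, hφ, hψ]⟩

theorem imp (hP : UniformlyDefinable Γ P) (hQ : UniformlyDefinable Γ Q) :
    UniformlyDefinable Γ fun R _ v => P R v → Q R v := by
  obtain ⟨φ, hφ⟩ := hP
  obtain ⟨ψ, hψ⟩ := hQ
  exact ⟨φ.imp ψ, fun R _ _ v => by rw [Formula.realize_imp, hφ, hψ]⟩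

theorem ex {P : ∀ (R : Type u) [CommRing R], (Γ → R) → R → Prop}
    (hP : UniformlyDefinable (Option Γ) fun R _ v => P R (fun i => v (some i)) (v none)) :
    UniformlyDefinable Γ fun R _ v => ∃ x, P R v x := by
  obtain ⟨φ, hφ⟩ := hP
  let g : Option Γ → Γ ⊕ Unit := fun o => o.elim (Sum.inr ()) Sum.inl
  refine ⟨(φ.relabel g).iExs Unit, fun R _ _ v => ?_⟩
  simp only [Formula.realize_iExs, Formula.realize_relabel, hφ]
  exact ⟨fun ⟨i, hi⟩ => ⟨i (), hi⟩, fun ⟨x, hx⟩ => ⟨fun _ => x, hx⟩⟩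

theorem all {P : ∀ (R : Type u) [CommRing R], (Γ → R) → R → Prop}
    (hP : UniformlyDefinable (Option Γ) fun R _ v => P R (fun i => v (some i)) (v none)) :
    UniformlyDefinable Γ fun R _ v => ∀ x, P R v x := by
  simpa only [not_exists, not_not] using (ex (P := fun R _ v x => ¬ P R v x) hP.not).not

theorem dvd (hs : UniformlyTerm Γ s) (ht : UniformlyTerm Γ t) :
    UniformlyDefinable Γ fun R _ v => s R v ∣ t R v :=
  ex (P := fun R _ v c => t R v = s R v * c) (eq ht.weaken (hs.weaken.mul (.var none)))

theorem isUnit (hs : UniformlyTerm Γ s) : UniformlyDefinable Γ fun R _ v => IsUnit (s R v) := by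
  simpa only [isUnit_iff_dvd_one] using dvd hs .one

/-- Uniformly definable properties are preserved by ring isomorphisms. -/
theorem iff_of_ringEquiv (hP : UniformlyDefinable Γ P) {R S : Type u} [CommRing R] [CommRing S]
    (e : R ≃+* S) (v : Γ → R) : P R v ↔ P S (e ∘ v) := by
  obtain ⟨φ, hφ⟩ := hP
  let _ := compatibleRingOfRing R
  let _ := compatibleRingOfRing S
  rw [← hφ, ← hφ]
  exact (StrongHomClass.realize_formula (languageEquivEquivRingEquiv.symm e) φ).symm

/-- Elementarily equivalent rings satisfy the same uniformly definable sentences. -/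
theorem iff_of_elementarilyEquivalent {P : ∀ (R : Type u) [CommRing R], Prop}
    (hP : UniformlyDefinable Empty fun R _ _ => P R) {R S : Type u} [CommRing R] [CommRing S]
    [CompatibleRing R] [CompatibleRing S] (h : R ≅[Language.ring] S) : P R ↔ P S := by
  obtain ⟨φ, hφ⟩ := hP
  exact (hφ R default).symm.trans ((h.realize_sentence φ).trans (hφ S default))

end UniformlyDefinable

/-! ### The defining predicates -/

section Predicates

variable {R : Type u} [CommRing R]

/-- In `K[t,t⁻¹]` this defines the constants. -/
def IsConst (x : R) : Prop := (x = 0 ∨ IsUnit x) ∧ (x + 1 = 0 ∨ IsUnit (x + 1))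

/-- In `K[t,t⁻¹]`, with `s = t`, this defines the prime field: `y` is a ratio of the
derivatives at `1` of two powers of `t`. -/
def IsRatConst (s y : R) : Prop :=
  IsConst y ∧ ∃ a b, IsUnit a ∧ IsUnit b ∧ b ≠ 1 ∧ s - 1 ∣ a - 1 ∧ s - 1 ∣ b - 1 ∧
    (s - 1) ^ 2 ∣ (a - 1) - y * (b - 1)

/-- `f` takes values in `F` at the nonzero elements of `F`; in `K[t,t⁻¹]`, with `s = t` and `F` a
subfield of `K`, this defines `F[t,t⁻¹]`. -/
def PreservesValues (s : R) (F : R → Prop) (f : R) : Prop :=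
  ∀ a v, F a → a ≠ 0 → IsConst v → s - a ∣ f - v → F v

/-- In `K[t,t⁻¹]`, with `s = t`, this defines the subfield of `K` generated by `l`. -/
def InField (s : R) : List R → R → Prop
  | [] => IsRatConst s
  | x :: l => fun y => IsConst y ∧ ∃ f g, PreservesValues s (InField s l) f ∧
      PreservesValues s (InField s l) g ∧ ¬ s - x ∣ g ∧ s - x ∣ y * g - f

/-- In `K[t,t⁻¹]`, with `s = t`, this says that `K` contains `n` elements algebraically
independent over the subfield generated by `l`. -/
def HasIndep (s : R) : ℕ → List R → Prop
  | 0, _ => True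
  | n + 1, l => ∃ x, IsConst x ∧ x ≠ 0 ∧
      (∀ f, PreservesValues s (InField s l) f → s - x ∣ f → f = 0) ∧ HasIndep s n (x :: l)

/-- In `K[t,t⁻¹]` this defines the elements `c t` and `c t⁻¹`. -/
def IsParam (s : R) : Prop :=
  IsUnit s ∧ ¬ IsConst s ∧ ∀ f, ∃ v, IsConst v ∧ s - 1 ∣ f - v

end Predicates

namespace UniformlyDefinable

variable {Γ : Type} {s t : ∀ (R : Type u) [CommRing R], (Γ → R) → R}

theorem isConst (ht : UniformlyTerm Γ t) : UniformlyDefinable Γ fun R _ v => IsConst (t R v) :=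
  ((eq ht .zero).or (isUnit ht)).and ((eq (ht.add .one) .zero).or (isUnit (ht.add .one)))

theorem isRatConst (hs : UniformlyTerm Γ s) (ht : UniformlyTerm Γ t) :
    UniformlyDefinable Γ fun R _ v => IsRatConst (s R v) (t R v) := by
  refine (isConst ht).and (ex (ex ?_))
  have hs' := (hs.weaken.weaken.sub .one)
  have ha : UniformlyTerm (Option (Option Γ)) fun R _ v => v (some none) := .var _
  have hb : UniformlyTerm (Option (Option Γ)) fun R _ v => v none := .var _
  exact (isUnit ha).and <| (isUnit hb).and <| (eq hb .one).not.and <|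
    (dvd hs' (ha.sub .one)).and <| (dvd hs' (hb.sub .one)).and <|
    dvd (hs'.pow 2) ((ha.sub .one).sub (ht.weaken.weaken.mul (hb.sub .one)))

theorem preservesValues {F : ∀ (R : Type u) [CommRing R], (Γ → R) → R → Prop}
    (hs : UniformlyTerm Γ s) (ht : UniformlyTerm Γ t)
    (hF₁ : UniformlyDefinable (Option (Option Γ))
      fun R _ v => F R (fun i => v (some (some i))) (v (some none)))
    (hF₂ : UniformlyDefinable (Option (Option Γ))
      fun R _ v => F R (fun i => v (some (some i))) (v none)) :
    UniformlyDefinable Γ fun R _ v => PreservesValues (s R v) (F R v) (t R v) := by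
  refine all (all ?_)
  exact hF₁.imp <| (eq (.var (some none)) .zero).not.imp <| (isConst (.var none)).imp <|
    (dvd (hs.weaken.weaken.sub (.var (some none))) (ht.weaken.weaken.sub (.var none))).imp hF₂

theorem inField {l : ∀ (R : Type u) [CommRing R], (Γ → R) → List R} (hl : UniformlyTermList Γ l)
    {Δ : Type} (ρ : Γ → Δ) {s t : ∀ (R : Type u) [CommRing R], (Δ → R) → R}
    (hs : UniformlyTerm Δ s) (ht : UniformlyTerm Δ t) :
    UniformlyDefinable Δ fun R _ v => InField (s R v) (l R fun i => v (ρ i)) (t R v) := by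
  induction hl generalizing Δ with
  | nil => exact isRatConst hs ht
  | @cons x l hx _ ih =>
    refine (isConst ht).and (ex (ex ?_))
    have hs' := hs.weaken.weaken
    have hx' := (hx.relabel ρ).weaken.weaken
    have hf : UniformlyTerm (Option (Option Δ)) fun R _ v => v (some none) := .var _
    have hg : UniformlyTerm (Option (Option Δ)) fun R _ v => v none := .var _
    have key {f} (hf : UniformlyTerm (Option (Option Δ)) f) :
        UniformlyDefinable (Option (Option Δ)) fun R _ v => PreservesValues
          (s R fun i => v (some (some i)))
          (InField (s R fun i => v (some (some i))) (l R fun i => v (some (some (ρ i)))))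
          (f R v) :=
      preservesValues
        (F := fun R _ v => InField (s R fun i => v (some (some i)))
          (l R fun i => v (some (some (ρ i))))) hs' hf
        (ih (fun i => some (some (some (some (ρ i))))) hs'.weaken.weaken (.var (some none)))
        (ih (fun i => some (some (some (some (ρ i))))) hs'.weaken.weaken (.var none))
    exact (key hf).and <| (key hg).and <| (dvd (hs'.sub hx') hg).not.and <|
      dvd (hs'.sub hx') ((ht.weaken.weaken.mul hg).sub hf)

theorem hasIndep (n : ℕ) {l : ∀ (R : Type u) [CommRing R], (Γ → R) → List R}
    (hl : UniformlyTermList Γ l) (hs : UniformlyTerm Γ s) :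
    UniformlyDefinable Γ fun R _ v => HasIndep (s R v) n (l R v) := by
  induction n generalizing Γ with
  | zero => exact true
  | succ n ih =>
    refine ex ?_
    have hx : UniformlyTerm (Option Γ) fun R _ v => v none := .var _
    refine (isConst hx).and <| (eq hx .zero).not.and <| .and (all ?_)
      (ih (l := fun R _ v => v none :: l R fun i => v (some i)) (.cons hx hl.weaken) hs.weaken)
    have hs' := hs.weaken.weaken
    have hf : UniformlyTerm (Option (Option Γ)) fun R _ v => v none := .var _
    exact (preservesValues
        (F := fun R _ v => InField (s R fun i => v (some (some i)))
          (l R fun i => v (some (some i)))) hs' hf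
        (inField hl (fun i => some (some (some (some i)))) hs'.weaken.weaken (.var (some none)))
        (inField hl (fun i => some (some (some (some i)))) hs'.weaken.weaken (.var none))).imp <|
      (dvd (hs'.sub hx.weaken) hf).imp (eq hf .zero)

theorem isParam (hs : UniformlyTerm Γ s) : UniformlyDefinable Γ fun R _ v => IsParam (s R v) :=
  (isUnit hs).and <| (isConst hs).not.and <| all <| ex <| (isConst (.var none)).and <|
    dvd (hs.weaken.weaken.sub .one) ((UniformlyTerm.var (some none)).sub (.var none))

theorem exists_isParam_hasIndep (n : ℕ) :
    UniformlyDefinable.{u} Empty fun R _ _ => ∃ s : R, IsParam s ∧ HasIndep s n [] :=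
  ex ((isParam (.var none)).and (hasIndep n .nil (.var none)))

end UniformlyDefinable

/-! ### Interpretation in Laurent polynomial rings -/

namespace LaurentPolynomial

variable {K : Type u} [Field K]

theorem isUnit_iff {f : K[T;T⁻¹]} : IsUnit f ↔ ∃ c : K, ∃ n : ℤ, c ≠ 0 ∧ f = C c * T n := by
  constructor
  · intro h
    obtain ⟨g, hg⟩ := h.exists_right_inv
    obtain ⟨n, p, hp⟩ := exists_T_pow f
    obtain ⟨m, q, hq⟩ := exists_T_pow g
    have hpq : p * q = Polynomial.X ^ (n + m) := by
      apply Polynomial.toLaurent_injective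
      rw [map_mul, hp, hq, Polynomial.toLaurent_X_pow, mul_mul_mul_comm, hg, one_mul, ← T_add]
      simp
    obtain ⟨i, -, hi⟩ := (dvd_prime_pow Polynomial.prime_X _).1 ⟨q, hpq.symm⟩
    obtain ⟨w, hw⟩ := hi.symm
    obtain ⟨c, hc, hcw⟩ := Polynomial.isUnit_iff.1 w.isUnit
    refine ⟨c, i - n, hc.ne_zero, ?_⟩
    have : f * T n * T (-n) = C c * T (i - n) := by
      rw [← hp, ← hw, ← hcw, map_mul, Polynomial.toLaurent_X_pow, Polynomial.toLaurent_C,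
        mul_comm (T _), mul_assoc, ← T_add, sub_eq_add_neg]
    rwa [mul_T_assoc, add_neg_cancel, T_zero, mul_one] at this
  · rintro ⟨c, n, hc, rfl⟩
    exact (hc.isUnit.map C).mul (isUnit_T n)

theorem coeff_C_mul_T (c : K) (n m : ℤ) : (C c * T n).coeff m = if n = m then c else 0 := by
  rw [← single_eq_C_mul_T, AddMonoidAlgebra.coeff_single, Finsupp.single_apply]

theorem coeff_one (m : ℤ) : (1 : K[T;T⁻¹]).coeff m = if 0 = m then 1 else 0 := by
  simpa using coeff_C_mul_T (1 : K) 0 m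

theorem isConst_C_mul_T {c : K} (hc : c ≠ 0) {n : ℤ} (h : IsConst (C c * T n)) : n = 0 := by
  by_contra hn
  rcases h.2 with h | h
  · have := congrArg (fun f => f.coeff 0) h
    simp [coeff_C_mul_T, hn] at this
  · obtain ⟨d, m, hd, h⟩ := isUnit_iff.1 h
    have h₀ := congrArg (fun f => f.coeff 0) h
    have h₁ := congrArg (fun f => f.coeff n) h
    simp only [AddMonoidAlgebra.coeff_add, Finsupp.add_apply, coeff_C_mul_T, coeff_one] at h₀ h₁
    grind

theorem isConst_iff {f : K[T;T⁻¹]} : IsConst f ↔ ∃ c : K, f = C c := by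
  constructor
  · intro h
    rcases h.1 with h0 | hu
    · exact ⟨0, by simpa using h0⟩
    · obtain ⟨c, n, hc, rfl⟩ := isUnit_iff.1 hu
      exact ⟨c, by simp [isConst_C_mul_T hc h]⟩
  · rintro ⟨c, rfl⟩
    have key (d : K) : C d = 0 ∨ IsUnit (C d) := by
      by_cases hd : d = 0
      · simp [hd]
      · exact .inr ((Ne.isUnit hd).map C)
    exact ⟨key c, by simpa using key (c + 1)⟩

/-- Evaluation of Laurent polynomials at a unit. -/
noncomputable def evalUnit (a : Kˣ) : K[T;T⁻¹] →+* K := eval₂ (RingHom.id K) a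

@[simp]
theorem evalUnit_C (a : Kˣ) (c : K) : evalUnit a (C c) = c := by simp [evalUnit]

theorem C_inj {c d : K} (h : (C c : K[T;T⁻¹]) = C d) : c = d := by
  simpa using congrArg (evalUnit 1) h

@[simp]
theorem evalUnit_T (a : Kˣ) (n : ℤ) : evalUnit a (T n) = (a : K) ^ n := by simp [evalUnit]

@[simp]
theorem evalUnit_toLaurent (a : Kˣ) (p : Polynomial K) :
    evalUnit a (Polynomial.toLaurent p) = p.eval (a : K) := by
  simp [evalUnit, Polynomial.eval₂_eq_eval_map]

theorem T_one_sub_C_dvd_iff {a : K} (ha : a ≠ 0) {f : K[T;T⁻¹]} :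
    T 1 - C a ∣ f ↔ evalUnit (Units.mk0 a ha) f = 0 := by
  constructor
  · rintro ⟨g, rfl⟩
    simp
  · intro h
    obtain ⟨n, p, hp⟩ := exists_T_pow f
    have hroot : p.IsRoot a := by
      have := evalUnit_toLaurent (Units.mk0 a ha) p
      rw [hp, map_mul, h, zero_mul] at this
      exact this.symm
    obtain ⟨q, hq⟩ := Polynomial.dvd_iff_isRoot.2 hroot
    refine ((isUnit_T (R := K) n).dvd_mul_right).1 ⟨Polynomial.toLaurent q, ?_⟩
    rw [← hp, hq]
    simp

theorem T_one_sub_C_dvd_sub_C_iff {a : K} (ha : a ≠ 0) {f : K[T;T⁻¹]} {v : K} :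
    T 1 - C a ∣ f - C v ↔ evalUnit (Units.mk0 a ha) f = v := by
  rw [T_one_sub_C_dvd_iff ha, map_sub, evalUnit_C, sub_eq_zero]

theorem T_one_sub_one_dvd_iff {f : K[T;T⁻¹]} : T 1 - 1 ∣ f ↔ evalUnit 1 f = 0 := by
  simpa using! T_one_sub_C_dvd_iff (one_ne_zero (α := K)) (f := f)

theorem sq_dvd_T_sub (n : ℤ) : (T 1 - 1 : K[T;T⁻¹]) ^ 2 ∣ T n - 1 - C (n : K) * (T 1 - 1) := by
  induction n with
  | zero => simp
  | succ n ih =>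
    obtain ⟨g, hg⟩ := ih
    refine ⟨T 1 * g + C (n : K), ?_⟩
    rw [sub_sub, sub_eq_iff_eq_add] at hg
    rw [T_add, hg]
    push_cast
    simp only [map_add, map_one]
    ring
  | pred n ih =>
    obtain ⟨g, hg⟩ := ih
    rw [sub_sub, sub_eq_iff_eq_add] at hg
    have hT : (T (-1) : K[T;T⁻¹]) * T 1 = 1 := by rw [← T_add]; simp
    have hT1 : (T (-1) : K[T;T⁻¹]) - 1 = - (T (-1) * (T 1 - 1)) := by linear_combination hT
    refine ⟨T (-1) * g + C (n + 1 : K) * T (-1), ?_⟩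
    rw [T_sub, hg]
    push_cast
    simp only [map_add, map_one, map_sub, map_neg]
    linear_combination (1 - (C (n : K) + 1) * (T 1 - 1)) * hT1

theorem isRatConst_C_iff [CharZero K] {y : K} :
    IsRatConst (T 1) (C y) ↔ y ∈ (⊥ : Subfield K) := by
  have hsq : (T 1 - 1 : K[T;T⁻¹]) ≠ 0 := by
    intro h
    have := congrArg (fun f => f.coeff 0) h
    simp at this
  constructor
  · rintro ⟨-, a, b, ha, hb, hb1, ha', hb', h⟩
    obtain ⟨c, n, hc, rfl⟩ := isUnit_iff.1 ha
    obtain ⟨d, m, hd, rfl⟩ := isUnit_iff.1 hb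
    obtain rfl : c = 1 := by simpa [sub_eq_zero] using T_one_sub_one_dvd_iff.1 ha'
    obtain rfl : d = 1 := by simpa [sub_eq_zero] using T_one_sub_one_dvd_iff.1 hb'
    have hm : (m : K) ≠ 0 := by
      rw [Int.cast_ne_zero]
      rintro rfl
      simp at hb1
    have key : (T 1 - 1 : K[T;T⁻¹]) ^ 2 ∣ (T 1 - 1) * C (n - y * m) := by
      have := dvd_sub h (dvd_sub (sq_dvd_T_sub n) ((sq_dvd_T_sub m).mul_left (C y)))
      convert this using 1
      simp only [map_sub, map_mul, map_one]
      ring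
    rw [pow_two, mul_dvd_mul_iff_left hsq, T_one_sub_one_dvd_iff, evalUnit_C, sub_eq_zero] at key
    rw [eq_div_of_mul_eq hm key.symm]
    exact div_mem (intCast_mem _ _) (intCast_mem _ _)
  · intro hy
    obtain ⟨q, rfl⟩ : ∃ q : ℚ, (q : K) = y := by
      have : (⊥ : Subfield K) ≤ (Rat.castHom K).fieldRange := bot_le
      simpa using! this hy
    refine ⟨isConst_iff.2 ⟨_, rfl⟩, T q.num, T q.den, isUnit_T _, isUnit_T _, ?_,
      T_one_sub_one_dvd_iff.2 (by simp), T_one_sub_one_dvd_iff.2 (by simp), ?_⟩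
    · intro h
      have := congrArg (fun f => f.coeff 0) h
      simp at this
    · have := dvd_sub (sq_dvd_T_sub (K := K) q.num)
        ((sq_dvd_T_sub (K := K) q.den).mul_left (C (q : K)))
      convert this using 1
      have h : (q : K) * (q.den : K) = q.num := by exact_mod_cast q.mul_den_eq_num
      push_cast
      rw [← h, map_mul]
      ring

/-- A polynomial taking values in a subfield at the positive integers has coefficients there. -/
theorem exists_map_subtype_eq_of_eval_natCast_mem [CharZero K] {F : Subfield K} {p : Polynomial K}
    (h : ∀ i : ℕ, p.eval ((i + 1 : ℕ) : K) ∈ F) :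
    ∃ q : Polynomial F, q.map F.subtype = p := by
  obtain ⟨r, hr⟩ : ∃ r : ℕ → F, ∀ i, F.subtype (r i) = p.eval ((i + 1 : ℕ) : K) :=
    ⟨fun i => ⟨_, h i⟩, fun _ => rfl⟩
  obtain ⟨x, hx⟩ : ∃ x : ℕ → F, ∀ i, F.subtype (x i) = ((i + 1 : ℕ) : K) :=
    ⟨fun i => (i + 1 : ℕ), fun i => map_natCast F.subtype _⟩
  obtain ⟨s, hs⟩ : ∃ s : Finset ℕ, s.card = p.natDegree + 1 := ⟨_, Finset.card_range _⟩
  have hinj' : Set.InjOn (fun i => F.subtype (x i)) s := fun i _ j _ hij => by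
    simpa only [hx, Nat.cast_inj, add_left_inj] using hij
  have hinj : Set.InjOn x s := fun i hi j hj hij => hinj' hi hj (congrArg F.subtype hij)
  refine ⟨Lagrange.interpolate s x r, ?_⟩
  refine Polynomial.eq_of_degrees_lt_of_eval_index_eq s hinj' ?_ ?_ fun i hi => ?_
  · rw [Polynomial.degree_map]
    exact Lagrange.degree_interpolate_lt _ hinj
  · rw [hs]
    exact Polynomial.degree_le_natDegree.trans_lt (by exact_mod_cast p.natDegree.lt_succ_self)
  · rw [Polynomial.eval_map_apply, Lagrange.eval_interpolate_at_node _ hinj hi, hr, hx]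

/-- The Laurent polynomials with coefficients in a subfield, up to multiplication by a power of
`T 1`, are those taking values in the subfield at its nonzero elements. -/
theorem preservesValues_iff [CharZero K] {F : Subfield K} {f : K[T;T⁻¹]} {P : K[T;T⁻¹] → Prop}
    (hP : ∀ y, P y ↔ ∃ c ∈ F, y = C c) :
    PreservesValues (T 1) P f ↔
      ∃ (n : ℕ) (p : Polynomial F), Polynomial.toLaurent (p.map F.subtype) = f * T n := by
  have hval : PreservesValues (T 1) P f ↔ ∀ a : Kˣ, (a : K) ∈ F → evalUnit a f ∈ F := by
    constructor
    · intro h a ha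
      obtain ⟨c, hc, hac⟩ := (hP _).1 <| h (C a) (C (evalUnit a f)) ((hP _).2 ⟨a, ha, rfl⟩)
        (by simp) (isConst_iff.2 ⟨_, rfl⟩)
        ((T_one_sub_C_dvd_sub_C_iff a.ne_zero).2 (by simp))
      rwa [C_inj hac]
    · rintro h a v ha ha0 hv hdvd
      obtain ⟨a, haF, rfl⟩ := (hP _).1 ha
      obtain ⟨v, rfl⟩ := isConst_iff.1 hv
      have ha0' : a ≠ 0 := by rintro rfl; simp at ha0
      rw [T_one_sub_C_dvd_sub_C_iff ha0'] at hdvd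
      exact (hP _).2 ⟨v, hdvd ▸ h _ haF, rfl⟩
  rw [hval]
  constructor
  · intro h
    obtain ⟨n, p, hp⟩ := exists_T_pow f
    have hpF (i : ℕ) : p.eval ((i + 1 : ℕ) : K) ∈ F := by
      have hi : ((i + 1 : ℕ) : K) ≠ 0 := Nat.cast_ne_zero.2 i.succ_ne_zero
      have := evalUnit_toLaurent (Units.mk0 _ hi) p
      rw [Units.val_mk0] at this
      rw [← this, hp, map_mul, evalUnit_T]
      exact mul_mem (h _ (natCast_mem F _)) (zpow_mem (natCast_mem F _) _)
    obtain ⟨q, hq⟩ := exists_map_subtype_eq_of_eval_natCast_mem hpF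
    exact ⟨n, q, by rw [hq, hp]⟩
  · rintro ⟨n, p, hp⟩ a ha
    have := evalUnit_toLaurent a (p.map F.subtype)
    rw [hp, map_mul, evalUnit_T] at this
    have han : (a : K) ^ (n : ℤ) ≠ 0 := zpow_ne_zero _ a.ne_zero
    rw [eq_div_of_mul_eq han this]
    refine div_mem ?_ (zpow_mem ha _)
    have := Polynomial.eval_map_apply (f := F.subtype) (p := p) (⟨a, ha⟩ : F)
    rw [Subfield.subtype_apply] at this
    rw [this]
    exact (p.eval _).2

end LaurentPolynomial

/-! ### Transcendence degree and simple extensions -/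

open scoped IntermediateField.algebraAdjoinAdjoin in
theorem Algebra.one_add_trdeg_adjoin_simple {F K : Type u} [Field F] [Field K] [Algebra F K]
    {x : K} (hx : Transcendental F x) :
    1 + Algebra.trdeg (IntermediateField.adjoin F {x}) K = Algebra.trdeg F K := by
  have h1 : Algebra.trdeg F (Algebra.adjoin F {x}) = 1 := by
    rw [← Polynomial.trdeg_of_isDomain (R := F)]
    exact (Polynomial.algEquivOfTranscendental F x hx).symm.trdeg_eq
  have h2 : Algebra.trdeg F (IntermediateField.adjoin F {x}) = 1 := by
    have : Algebra.trdeg (Algebra.adjoin F {x}) (IntermediateField.adjoin F {x}) = 0 :=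
      trdeg_eq_zero
    rw [← trdeg_add_eq F (Algebra.adjoin F {x}), h1, this, add_zero]
  rw [← h2, trdeg_add_eq]

theorem Algebra.natCast_succ_le_trdeg_iff {F K : Type u} [Field F] [Field K] [Algebra F K]
    (n : ℕ) : ((n + 1 : ℕ) : Cardinal) ≤ Algebra.trdeg F K ↔
      ∃ x : K, Transcendental F x ∧ n ≤ Algebra.trdeg (IntermediateField.adjoin F {x}) K := by
  have key {x : K} (hx : Transcendental F x) : ((n + 1 : ℕ) : Cardinal) ≤ Algebra.trdeg F K ↔
      n ≤ Algebra.trdeg (IntermediateField.adjoin F {x}) K := by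
    rw [← Algebra.one_add_trdeg_adjoin_simple hx, Nat.cast_succ, add_comm 1,
      Cardinal.add_one_le_add_one_iff]
  refine ⟨fun h => ?_, fun ⟨x, hx, h⟩ => (key hx).2 h⟩
  obtain ⟨⟨x, hx⟩⟩ : Algebra.Transcendental F K := by
    rw [← trdeg_ne_zero_iff]
    intro h0
    rw [h0] at h
    simp at h
  exact ⟨x, hx, (key hx).1 h⟩

theorem Subfield.isAlgebraic_bot (K : Type u) [Field K] [CharZero K] :
    Algebra.IsAlgebraic ℚ (⊥ : Subfield K) := by
  refine ⟨fun ⟨y, hy⟩ => ?_⟩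
  obtain ⟨q, rfl⟩ : ∃ q : ℚ, (q : K) = y := by
    have : (⊥ : Subfield K) ≤ (Rat.castHom K).fieldRange := bot_le
    simpa using! this hy
  exact isAlgebraic_algebraMap q

theorem Algebra.trdeg_bot_subfield (K : Type u) [Field K] [CharZero K] :
    Algebra.trdeg (⊥ : Subfield K) K = Algebra.trdeg ℚ K := by
  have := Subfield.isAlgebraic_bot K
  simpa [trdeg_eq_zero] using lift_trdeg_add_eq ℚ (⊥ : Subfield K) K

namespace LaurentPolynomial

variable {K : Type u} [Field K]

/-- The subfield generated by a list of elements. -/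
noncomputable def subfieldOfList : List K → Subfield K
  | [] => ⊥
  | x :: l => (IntermediateField.adjoin (subfieldOfList l) {x}).toSubfield

theorem C_eq_zero_iff {c : K} : (C c : K[T;T⁻¹]) = 0 ↔ c = 0 := by
  rw [← C.map_zero]
  exact ⟨C_inj, congrArg _⟩

section

variable {F : Subfield K} {P : K[T;T⁻¹] → Prop}

theorem preservesValues_toLaurent [CharZero K] (hP : ∀ y, P y ↔ ∃ c ∈ F, y = C c)
    (p : Polynomial F) :
    PreservesValues (T 1) P (Polynomial.toLaurent (p.map F.subtype)) :=
  (preservesValues_iff hP).2 ⟨0, p, by simp⟩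

theorem evalUnit_toLaurent_map {x : K} (hx : x ≠ 0) (p : Polynomial F) :
    evalUnit (Units.mk0 x hx) (Polynomial.toLaurent (p.map F.subtype)) = p.aeval x := by
  rw [evalUnit_toLaurent, Polynomial.aeval_def, Polynomial.eval₂_eq_eval_map]
  rfl

theorem evalUnit_mem_adjoin [CharZero K] (hP : ∀ y, P y ↔ ∃ c ∈ F, y = C c) {x : K} (hx : x ≠ 0)
    {f : K[T;T⁻¹]} (hf : PreservesValues (T 1) P f) :
    evalUnit (Units.mk0 x hx) f ∈ IntermediateField.adjoin F {x} := by
  obtain ⟨n, p, hp⟩ := (preservesValues_iff hP).1 hf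
  have := evalUnit_toLaurent_map hx p
  rw [hp, map_mul, evalUnit_T] at this
  have hmem := IntermediateField.mem_adjoin_simple_self F x
  rw [eq_div_of_mul_eq (zpow_ne_zero _ (Units.ne_zero _)) this]
  refine div_mem ?_ (zpow_mem hmem _)
  exact IntermediateField.algebra_adjoin_le_adjoin F {x}
    (Polynomial.aeval_mem_adjoin_singleton F x)

theorem transcendental_iff [CharZero K] (hP : ∀ y, P y ↔ ∃ c ∈ F, y = C c) {x : K} (hx : x ≠ 0) :
    (∀ f, PreservesValues (T 1) P f → T 1 - C x ∣ f → f = 0) ↔ Transcendental F x := by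
  rw [_root_.transcendental_iff]
  constructor
  · intro h p hp
    have := h _ (preservesValues_toLaurent hP p)
      ((T_one_sub_C_dvd_iff hx).2 (by rw [evalUnit_toLaurent_map, hp]))
    rwa [Polynomial.toLaurent_eq_zero, Polynomial.map_eq_zero] at this
  · intro h f hf hdvd
    obtain ⟨n, p, hp⟩ := (preservesValues_iff hP).1 hf
    have hpx := evalUnit_toLaurent_map hx p
    rw [hp, map_mul, (T_one_sub_C_dvd_iff hx).1 hdvd, zero_mul] at hpx
    rw [h p hpx.symm, Polynomial.map_zero, map_zero] at hp
    exact ((isUnit_T (R := K) n).mul_left_eq_zero).1 hp.symm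

end

theorem inField_iff [CharZero K] (l : List K) (hl : ∀ x ∈ l, x ≠ 0) (y : K[T;T⁻¹]) :
    InField (T 1) (l.map C) y ↔ ∃ c ∈ subfieldOfList l, y = C c := by
  induction l generalizing y with
  | nil =>
    constructor
    · intro h
      obtain ⟨c, rfl⟩ := isConst_iff.1 h.1
      exact ⟨c, isRatConst_C_iff.1 h, rfl⟩
    · rintro ⟨c, hc, rfl⟩
      exact isRatConst_C_iff.2 hc
  | cons x l ih =>
    have hx : x ≠ 0 := hl x (by simp)
    have hP := ih fun z hz => hl z (by simp [hz])
    constructor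
    · rintro ⟨hy, f, g, hf, hg, hgx, hfg⟩
      obtain ⟨c, rfl⟩ := isConst_iff.1 hy
      refine ⟨c, ?_, rfl⟩
      rw [T_one_sub_C_dvd_iff hx] at hgx hfg
      rw [map_sub, map_mul, evalUnit_C, sub_eq_zero] at hfg
      rw [eq_div_of_mul_eq hgx hfg]
      exact div_mem (evalUnit_mem_adjoin hP hx hf) (evalUnit_mem_adjoin hP hx hg)
    · rintro ⟨c, hc, rfl⟩
      refine ⟨isConst_iff.2 ⟨c, rfl⟩, ?_⟩
      obtain ⟨p, q, hpq⟩ := (IntermediateField.mem_adjoin_simple_iff _ _).1 hc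
      by_cases hq : q.aeval x = 0
      · refine ⟨Polynomial.toLaurent ((0 : Polynomial (subfieldOfList l)).map (Subfield.subtype _)),
          Polynomial.toLaurent ((1 : Polynomial (subfieldOfList l)).map (Subfield.subtype _)),
          preservesValues_toLaurent hP _, preservesValues_toLaurent hP _, ?_, ?_⟩
        · rw [T_one_sub_C_dvd_iff hx]
          simp
        · rw [T_one_sub_C_dvd_iff hx]
          simp [hpq, hq]
      · refine ⟨_, _, preservesValues_toLaurent hP p, preservesValues_toLaurent hP q, ?_, ?_⟩
        · rwa [T_one_sub_C_dvd_iff hx, evalUnit_toLaurent_map]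
        · rw [T_one_sub_C_dvd_iff hx, map_sub, map_mul, evalUnit_C, evalUnit_toLaurent_map,
            evalUnit_toLaurent_map, hpq, div_mul_cancel₀ _ hq, sub_self]

theorem hasIndep_iff [CharZero K] (n : ℕ) (l : List K) (hl : ∀ x ∈ l, x ≠ 0) :
    HasIndep (T 1) n (l.map C) ↔ n ≤ Algebra.trdeg (subfieldOfList l) K := by
  induction n generalizing l with
  | zero => simp [HasIndep]
  | succ n ih =>
    rw [Algebra.natCast_succ_le_trdeg_iff]
    constructor
    · rintro ⟨x, hx, hx0, hf, h⟩
      obtain ⟨x, rfl⟩ := isConst_iff.1 hx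
      rw [Ne, C_eq_zero_iff] at hx0
      exact ⟨x, (transcendental_iff (inField_iff l hl) hx0).1 hf,
        (ih (x :: l) (by simpa using ⟨hx0, hl⟩)).1 h⟩
    · rintro ⟨x, hx, h⟩
      have hx0 : x ≠ 0 := by
        rintro rfl
        exact hx isAlgebraic_zero
      exact ⟨C x, isConst_iff.2 ⟨x, rfl⟩, C_eq_zero_iff.not.2 hx0,
        (transcendental_iff (inField_iff l hl) hx0).2 hx,
        (ih (x :: l) (by simpa using ⟨hx0, hl⟩)).2 h⟩

end LaurentPolynomial

/-! ### Parameters of Laurent polynomial rings -/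

namespace LaurentPolynomial

variable {K : Type u} [Field K]

/-- The endomorphism of the Laurent polynomials sending `T 1` to `C c * T m`. -/
noncomputable def monomialHom (c : K) (hc : c ≠ 0) (m : ℤ) : K[T;T⁻¹] →ₐ[K] K[T;T⁻¹] :=
  AddMonoidAlgebra.lift K K[T;T⁻¹] ℤ
    { toFun n := C (c ^ n.toAdd) * T (m * n.toAdd)
      map_one' := by simp
      map_mul' a b := by
        rw [toAdd_mul, zpow_add₀ hc, mul_add, T_add, map_mul]
        ring }

theorem monomialHom_T (c : K) (hc : c ≠ 0) (m n : ℤ) :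
    monomialHom c hc m (T n) = C (c ^ n) * T (m * n) :=
  (AddMonoidAlgebra.lift_single _ _ _).trans (one_smul _ _)

theorem monomialHom_comp {c d : K} (hc : c ≠ 0) (hd : d ≠ 0) {m : ℤ} (hm : m * m = 1)
    (h : d * c ^ m = 1) :
    (monomialHom c hc m).comp (monomialHom d hd m) = AlgHom.id K K[T;T⁻¹] := by
  refine AddMonoidAlgebra.algHom_ext (fun n => ?_) (Subsingleton.elim _ _)
  change monomialHom c hc m (monomialHom d hd m (T n)) = T n
  rw [monomialHom_T, map_mul, monomialHom_T, C_eq_algebraMap, AlgHom.commutes, ← C_eq_algebraMap,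
    ← mul_assoc, ← map_mul, ← mul_assoc, hm, zpow_mul, ← mul_zpow, h]
  simp

theorem isParam_T_one : IsParam (T 1 : K[T;T⁻¹]) := by
  refine ⟨isUnit_T 1, fun h => ?_, fun f => ⟨C (evalUnit 1 f), isConst_iff.2 ⟨_, rfl⟩, ?_⟩⟩
  · exact one_ne_zero (isConst_C_mul_T (one_ne_zero (α := K)) (n := 1) (by simpa using h))
  · rw [T_one_sub_one_dvd_iff, map_sub, evalUnit_C, sub_self]

theorem exists_eq_of_isParam [IsAlgClosed K] [CharZero K] {s : K[T;T⁻¹]} (hs : IsParam s) :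
    ∃ c : K, ∃ m : ℤ, c ≠ 0 ∧ m * m = 1 ∧ s = C c * T m := by
  obtain ⟨hu, hs, h⟩ := hs
  obtain ⟨c, m, hc, rfl⟩ := isUnit_iff.1 hu
  refine ⟨c, m, hc, ?_, rfl⟩
  have hm : m.natAbs ≠ 0 := by
    rw [Int.natAbs_ne_zero]
    rintro rfl
    exact hs (isConst_iff.2 ⟨c, by simp⟩)
  have : NeZero m.natAbs := ⟨hm⟩
  obtain ⟨v, hv, hdvd⟩ := h (T 1)
  obtain ⟨w, rfl⟩ := isConst_iff.1 hv
  have huniq (r : Kˣ) (hr : c * (r : K) ^ m = 1) : (r : K) = w := by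
    have := map_dvd (evalUnit r) hdvd
    simpa [hr, sub_eq_zero] using this
  obtain ⟨x, hx⟩ := IsAlgClosed.exists_pow_nat_eq c (Nat.pos_of_ne_zero hm)
  have hx0 : x ≠ 0 := by
    rintro rfl
    exact hc (by simpa [hm] using hx.symm)
  obtain ⟨r, hr⟩ : ∃ r : Kˣ, c * (r : K) ^ m = 1 := by
    rcases Int.natAbs_eq m with h | h
    · refine ⟨(Units.mk0 x hx0)⁻¹, ?_⟩
      rw [h, zpow_natCast, ← hx]
      simp [hx0]
    · refine ⟨Units.mk0 x hx0, ?_⟩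
      rw [h, zpow_neg, zpow_natCast, ← hx]
      simp [hx0]
  obtain ⟨ζ, hζ⟩ := HasEnoughRootsOfUnity.exists_primitiveRoot K m.natAbs
  have hζm : ζ ^ m = 1 := by
    rcases Int.natAbs_eq m with h | h
    · rw [h, zpow_natCast, hζ.pow_eq_one]
    · rw [h, zpow_neg, zpow_natCast, hζ.pow_eq_one, inv_one]
  have hr' := huniq (r * Units.mk0 ζ (hζ.ne_zero hm)) (by
    simp [mul_zpow, hζm, hr])
  rw [Units.val_mul, Units.val_mk0, huniq r hr, mul_eq_left₀ (huniq r hr ▸ r.ne_zero)] at hr'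
  have : m.natAbs = 1 := by
    rw [hr'] at hζ
    exact hζ.unique .one
  rcases Int.natAbs_eq m with h | h <;> rw [h, this] <;> simp

theorem exists_ringEquiv_of_isParam [IsAlgClosed K] [CharZero K] {s : K[T;T⁻¹]}
    (hs : IsParam s) : ∃ e : K[T;T⁻¹] ≃+* K[T;T⁻¹], e (T 1) = s := by
  obtain ⟨c, m, hc, hm, rfl⟩ := exists_eq_of_isParam hs
  have hd : c ^ (-m) ≠ 0 := zpow_ne_zero _ hc
  refine ⟨(AlgEquiv.ofAlgHom (monomialHom c hc m) (monomialHom (c ^ (-m)) hd m)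
    (monomialHom_comp _ _ hm ?_) (monomialHom_comp _ _ hm ?_)).toRingEquiv, ?_⟩
  · rw [← zpow_add₀ hc, neg_add_cancel, zpow_zero]
  · rw [← zpow_mul, neg_mul, hm, zpow_neg, zpow_one, mul_inv_cancel₀ hc]
  · simp [monomialHom_T]

theorem exists_isParam_hasIndep_iff [IsAlgClosed K] [CharZero K] (n : ℕ) :
    (∃ s : K[T;T⁻¹], IsParam s ∧ HasIndep s n []) ↔ n ≤ Algebra.trdeg ℚ K := by
  have h₀ : HasIndep (T 1 : K[T;T⁻¹]) n [] ↔ n ≤ Algebra.trdeg ℚ K := by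
    rw [← Algebra.trdeg_bot_subfield]
    exact hasIndep_iff n [] (by simp)
  refine ⟨fun ⟨s, hs, h⟩ => ?_, fun h => ⟨T 1, isParam_T_one, h₀.2 h⟩⟩
  obtain ⟨e, rfl⟩ := exists_ringEquiv_of_isParam hs
  have := (UniformlyDefinable.hasIndep.{u} n .nil (.var ())).iff_of_ringEquiv e fun _ => T 1
  exact h₀.1 (this.2 h)

end LaurentPolynomial

/-! ### Extending partial isomorphisms between fields of infinite transcendence degree -/

/-- An extension of `F` of finite transcendence degree embeds over `F` into every algebraically
closed extension of `F` of infinite transcendence degree. -/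
theorem IsAlgClosed.nonempty_algHom_of_trdeg_lt_aleph0 {F E K : Type u} [Field F] [Field E]
    [Field K] [Algebra F E] [Algebra F K] [IsAlgClosed K] (hE : Algebra.trdeg F E < ℵ₀)
    (hK : ℵ₀ ≤ Algebra.trdeg F K) : Nonempty (E →ₐ[F] K) := by
  obtain ⟨s, hs⟩ := exists_isTranscendenceBasis F E
  obtain ⟨t, ht⟩ := exists_isTranscendenceBasis F K
  rw [← hs.cardinalMk_eq_trdeg] at hE
  rw [← ht.cardinalMk_eq_trdeg] at hK
  obtain ⟨g⟩ := Cardinal.le_def _ _ |>.1 (hE.le.trans hK)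
  have hind : AlgebraicIndependent F fun i : s => ((g i : t) : K) := ht.1.comp g g.injective
  let f : Algebra.adjoin F (Set.range ((↑) : s → E)) →ₐ[F] K :=
    (MvPolynomial.aeval fun i : s => ((g i : t) : K)).comp hs.1.aevalEquiv.symm.toAlgHom
  have hf : Function.Injective f := by
    rw [AlgebraicIndependent] at hind
    exact hind.comp hs.1.aevalEquiv.symm.injective
  let := f.toRingHom.toAlgebra
  have : Module.IsTorsionFree (Algebra.adjoin F (Set.range ((↑) : s → E))) K := by
    have : FaithfulSMul (Algebra.adjoin F (Set.range ((↑) : s → E))) K :=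
      (faithfulSMul_iff_algebraMap_injective _ _).2 hf
    infer_instance
  have : IsScalarTower F (Algebra.adjoin F (Set.range ((↑) : s → E))) K :=
    .of_algebraMap_eq fun x => (f.commutes x).symm
  have := hs.isAlgebraic
  exact ⟨(IsAlgClosed.lift (R := Algebra.adjoin F (Set.range ((↑) : s → E)))
    (S := E) (M := K)).restrictScalars F⟩

open scoped IntermediateField.algebraAdjoinAdjoin in
theorem Algebra.trdeg_adjoin_finset_lt_aleph0 (F : Type u) {K : Type u} [Field F] [Field K]
    [Algebra F K] (s : Finset K) :
    Algebra.trdeg F (IntermediateField.adjoin F (s : Set K)) < ℵ₀ := by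
  have h : Algebra.trdeg (Algebra.adjoin F (s : Set K))
      (IntermediateField.adjoin F (s : Set K)) = 0 := trdeg_eq_zero
  have : Algebra.FiniteType F (Algebra.adjoin F (s : Set K)) :=
    Subalgebra.fg_iff_finiteType _ |>.1 (Subalgebra.fg_adjoin_finset s)
  rw [← trdeg_add_eq F (Algebra.adjoin F (s : Set K)), h, add_zero]
  exact trdeg_lt_aleph0_of_finiteType

/-- The extension step of the back-and-forth argument. -/
theorem IsAlgClosed.exists_extension {F K L : Type u} [Field F] [Field K] [Field L] [CharZero F]
    [CharZero L] [IsAlgClosed L] (hF : Algebra.trdeg ℚ F < ℵ₀) (hL : ℵ₀ ≤ Algebra.trdeg ℚ L)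
    (i : F →+* K) (j : F →+* L) (s : Finset K) :
    ∃ (E : Type u) (_ : Field E) (_ : CharZero E) (k : F →+* E) (i' : E →+* K) (j' : E →+* L),
      Algebra.trdeg ℚ E < ℵ₀ ∧ i'.comp k = i ∧ j'.comp k = j ∧ ∀ x ∈ s, x ∈ i'.range := by
  let := i.toAlgebra
  let := j.toAlgebra
  have hE := Algebra.trdeg_adjoin_finset_lt_aleph0 F s
  have hFL : ℵ₀ ≤ Algebra.trdeg F L := by
    rw [← trdeg_add_eq ℚ F (A := L), Cardinal.aleph0_le_add_iff] at hL
    exact hL.resolve_left hF.not_ge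
  obtain ⟨j'⟩ := IsAlgClosed.nonempty_algHom_of_trdeg_lt_aleph0 hE hFL
  have hchar : CharZero (IntermediateField.adjoin F (s : Set K)) :=
    charZero_of_injective_algebraMap (algebraMap F _).injective
  refine ⟨IntermediateField.adjoin F (s : Set K), inferInstance, hchar,
    algebraMap F _, algebraMap _ K, j', ?_, rfl, j'.comp_algebraMap, fun x hx => ?_⟩
  · rw [← trdeg_add_eq ℚ F]
    exact Cardinal.add_lt_aleph0 hF hE
  · exact ⟨⟨x, IntermediateField.subset_adjoin F _ hx⟩, rfl⟩

namespace LaurentPolynomial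

theorem mem_range_mapRingHom {R S : Type*} [CommRing R] [CommRing S] (i : R →+* S) {f : S[T;T⁻¹]}
    (h : ∀ x ∈ f.coeff.frange, x ∈ i.range) : f ∈ (AddMonoidAlgebra.mapRingHom ℤ i).range := by
  rw [← f.sum_coeff_single]
  refine sum_mem fun n hn => ?_
  obtain ⟨r, hr⟩ := h (f.coeff n) (Finsupp.mem_frange.2 ⟨Finsupp.mem_support_iff.1 hn, n, rfl⟩)
  exact ⟨.single n r, by rw [AddMonoidAlgebra.mapRingHom_single, hr]⟩

theorem mapRingHom_injective {R S : Type*} [CommRing R] [CommRing S] {i : R →+* S}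
    (h : Function.Injective i) : Function.Injective (AddMonoidAlgebra.mapRingHom ℤ i) := by
  intro f g hfg
  ext n
  apply h
  rw [← AddMonoidAlgebra.coeff_mapRingHom, hfg, AddMonoidAlgebra.coeff_mapRingHom]

end LaurentPolynomial

/-! ### Elementary equivalence of Laurent polynomial rings -/

theorem FirstOrder.Ring.realize_term_map {R S α : Type*} [CommRing R] [CommRing S]
    [CompatibleRing R] [CompatibleRing S] (f : R →+* S) (t : Language.ring.Term α) (v : α → R) :
    t.realize (f ∘ v) = f (t.realize v) := by
  induction t with
  | var => rfl
  | func g ts ih => cases g <;> simp [Term.realize, ih]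

namespace LaurentPolynomial

section

variable {K L : Type u} [Field K] [Field L] [CharZero K] [CharZero L] [IsAlgClosed K]
  [IsAlgClosed L] [CompatibleRing K[T;T⁻¹]] [CompatibleRing L[T;T⁻¹]]

theorem realize_map_iff (hK : ℵ₀ ≤ Algebra.trdeg ℚ K) (hL : ℵ₀ ≤ Algebra.trdeg ℚ L) {α : Type}
    {n : ℕ} (φ : Language.ring.BoundedFormula α n) {F : Type u} [Field F] [CharZero F]
    (hF : Algebra.trdeg ℚ F < ℵ₀) (i : F →+* K) (j : F →+* L) (v : α → F[T;T⁻¹])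
    (c : Fin n → F[T;T⁻¹]) :
    φ.Realize (AddMonoidAlgebra.mapRingHom ℤ i ∘ v) (AddMonoidAlgebra.mapRingHom ℤ i ∘ c) ↔
      φ.Realize (AddMonoidAlgebra.mapRingHom ℤ j ∘ v) (AddMonoidAlgebra.mapRingHom ℤ j ∘ c) := by
  induction φ generalizing F with
  | falsum => rfl
  | equal t₁ t₂ =>
    let := compatibleRingOfRing F[T;T⁻¹]
    simp only [BoundedFormula.Realize, ← Sum.comp_elim, realize_term_map]
    rw [(mapRingHom_injective i.injective).eq_iff, (mapRingHom_injective j.injective).eq_iff]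
  | rel R => cases R
  | imp φ ψ ihφ ihψ => rw [BoundedFormula.realize_imp, BoundedFormula.realize_imp,
      ihφ hF, ihψ hF]
  | all φ ih =>
    rw [BoundedFormula.realize_all, BoundedFormula.realize_all]
    constructor
    · intro h b
      obtain ⟨E, _, _, k, j', i', hE, rfl, rfl, hb⟩ :=
        IsAlgClosed.exists_extension hF hK j i b.coeff.frange
      obtain ⟨b, rfl⟩ := mem_range_mapRingHom j' hb
      have := h (AddMonoidAlgebra.mapRingHom ℤ i' b)
      simp only [AddMonoidAlgebra.mapRingHom_comp, RingHom.coe_comp, Function.comp_assoc,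
        ← Fin.comp_snoc] at this ⊢
      exact (ih hE i' j' _ _).1 this
    · intro h b
      obtain ⟨E, _, _, k, i', j', hE, rfl, rfl, hb⟩ :=
        IsAlgClosed.exists_extension hF hL i j b.coeff.frange
      obtain ⟨b, rfl⟩ := mem_range_mapRingHom i' hb
      have := h (AddMonoidAlgebra.mapRingHom ℤ j' b)
      simp only [AddMonoidAlgebra.mapRingHom_comp, RingHom.coe_comp, Function.comp_assoc,
        ← Fin.comp_snoc] at this ⊢
      exact (ih hE i' j' _ _).2 this

theorem elementarilyEquivalent_of_aleph0_le (hK : ℵ₀ ≤ Algebra.trdeg ℚ K)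
    (hL : ℵ₀ ≤ Algebra.trdeg ℚ L) : K[T;T⁻¹] ≅[Language.ring] L[T;T⁻¹] := by
  refine elementarilyEquivalent_iff.2 fun φ => ?_
  have := Subfield.isAlgebraic_bot K
  have h := realize_map_iff hK hL φ (F := (⊥ : Subfield K))
    (by rw [trdeg_eq_zero]; exact Cardinal.aleph0_pos)
    (Subfield.subtype _)
    (IsAlgClosed.lift (R := ℚ) (S := (⊥ : Subfield K)) (M := L)).toRingHom
    default default
  rw [Sentence.Realize, Sentence.Realize, Formula.Realize, Formula.Realize]
  convert h

theorem elementarilyEquivalent_of_trdeg_eq (h : Algebra.trdeg ℚ K = Algebra.trdeg ℚ L) :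
    K[T;T⁻¹] ≅[Language.ring] L[T;T⁻¹] := by
  obtain ⟨s, hs⟩ := exists_isTranscendenceBasis ℚ K
  obtain ⟨t, ht⟩ := exists_isTranscendenceBasis ℚ L
  rw [← hs.cardinalMk_eq_trdeg, ← ht.cardinalMk_eq_trdeg] at h
  obtain ⟨g⟩ := Cardinal.eq.1 h
  exact StrongHomClass.elementarilyEquivalent (languageEquivEquivRingEquiv.symm
    (AddMonoidAlgebra.mapRingEquiv ℤ (IsAlgClosed.equivOfTranscendenceBasis _ _ g hs ht)))

theorem natCast_le_trdeg_iff_of_elementarilyEquivalent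
    (h : K[T;T⁻¹] ≅[Language.ring] L[T;T⁻¹]) (n : ℕ) :
    n ≤ Algebra.trdeg ℚ K ↔ n ≤ Algebra.trdeg ℚ L := by
  rw [← exists_isParam_hasIndep_iff, ← exists_isParam_hasIndep_iff]
  exact (UniformlyDefinable.exists_isParam_hasIndep n).iff_of_elementarilyEquivalent h

end

end LaurentPolynomial

theorem Cardinal.natCast_le_iff_natCast_le_iff {a b : Cardinal.{u}} :
    (∀ n : ℕ, n ≤ a ↔ n ≤ b) ↔ (ℵ₀ ≤ a ∧ ℵ₀ ≤ b) ∨ (a < ℵ₀ ∧ b < ℵ₀ ∧ a = b) := by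
  constructor
  · intro h
    have h' : ℵ₀ ≤ a ↔ ℵ₀ ≤ b := by
      rw [Cardinal.aleph0_le, Cardinal.aleph0_le]
      exact forall_congr' h
    rcases le_or_gt ℵ₀ a with ha | ha
    · exact .inl ⟨ha, h'.1 ha⟩
    · have hb : b < ℵ₀ := by simpa using h'.not.1 ha.not_ge
      refine .inr ⟨ha, hb, ?_⟩
      obtain ⟨m, rfl⟩ := Cardinal.lt_aleph0.1 ha
      obtain ⟨n, rfl⟩ := Cardinal.lt_aleph0.1 hb
      exact le_antisymm ((h m).1 le_rfl) ((h n).2 le_rfl)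
  · rintro (⟨ha, hb⟩ | ⟨-, -, rfl⟩) n
    · exact iff_of_true (Cardinal.natCast_le_aleph0.trans ha) (Cardinal.natCast_le_aleph0.trans hb)
    · rfl

/-- For algebraically closed fields `K₁`, `K₂` of characteristic zero, the Laurent
polynomial rings `K₁[t,t⁻¹]` and `K₂[t,t⁻¹]` are elementarily equivalent as rings iff
the transcendence degrees of `K₁` and `K₂` over `ℚ` are either both infinite, or both
finite and equal. -/
theorem laurent_elementarilyEquivalent_iff_trdeg
    (K₁ K₂ : Type u) [Field K₁] [Field K₂] [IsAlgClosed K₁] [IsAlgClosed K₂]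
    [CharZero K₁] [CharZero K₂] :
    letI := compatibleRingOfRing K₁[T;T⁻¹]
    letI := compatibleRingOfRing K₂[T;T⁻¹]
    ((K₁[T;T⁻¹] ≅[Language.ring] K₂[T;T⁻¹]) ↔
      ((ℵ₀ ≤ trdegQ K₁ ∧ ℵ₀ ≤ trdegQ K₂) ∨
        (trdegQ K₁ < ℵ₀ ∧ trdegQ K₂ < ℵ₀ ∧ trdegQ K₁ = trdegQ K₂))) := by
  let := compatibleRingOfRing K₁[T;T⁻¹]
  let := compatibleRingOfRing K₂[T;T⁻¹]
  refine ⟨fun h => Cardinal.natCast_le_iff_natCast_le_iff.1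
    (natCast_le_trdeg_iff_of_elementarilyEquivalent h), ?_⟩
  rintro (⟨h₁, h₂⟩ | ⟨-, -, h⟩)
  · exact elementarilyEquivalent_of_aleph0_le h₁ h₂
  · exact elementarilyEquivalent_of_trdeg_eq h
end

section
/- Let K₁ and K₂ be infinite fields of characteristic zero. If the polynomial rings K₁[t] and K₂[t] are elementarily equivalent as rings, then the transcendence degrees of K₁ and K₂ over ℚ are either both infinite, or both finite and equal. -/
open FirstOrder Language FirstOrder.Ring Polynomial Cardinal

universe u

namespace PolynomialRingFormula

/-! ### Polynomials with values in a subfield -/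

section Algebra

variable {K : Type*} [Field K] [CharZero K]

/-- A polynomial taking values in a subfield `E` at all natural numbers has coefficients in `E`. -/
theorem exists_map_eq_of_eval_natCast_mem (E : IntermediateField ℚ K) (g : K[X])
    (hg : ∀ n : ℕ, g.eval (n : K) ∈ E) : ∃ r : E[X], r.map (algebraMap E K) = g := by
  let N := Finset.range (g.natDegree + 1)
  let w : ℕ → E := fun i => i
  have hw : Set.InjOn w N := fun i _ j _ h => Nat.cast_injective h
  have hv : Set.InjOn (fun i : ℕ => (i : K)) N := fun i _ j _ h => Nat.cast_injective h
  refine ⟨Lagrange.interpolate N w fun i => ⟨_, hg i⟩, ?_⟩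
  refine eq_of_degrees_lt_of_eval_index_eq N hv ?_ ?_ fun i hi => ?_
  · rw [degree_map]
    exact Lagrange.degree_interpolate_lt _ hw
  · refine degree_le_natDegree.trans_lt ?_
    rw [Finset.card_range]
    exact_mod_cast Nat.lt_succ_self _
  · have h := congrArg (algebraMap E K)
      (Lagrange.eval_interpolate_at_node (r := fun i => (⟨_, hg i⟩ : E)) hw hi)
    rw [← eval_map_apply] at h
    simpa [w] using h

theorem eval_natCast_map_mem (E : IntermediateField ℚ K) (r : E[X]) (n : ℕ) :
    (r.map (algebraMap E K)).eval (n : K) ∈ E := by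
  rw [eval_natCast_map]
  exact (r.eval (n : E)).2

theorem isAlgebraic_iff_exists_eval_natCast_mem (E : IntermediateField ℚ K) (y : K) :
    IsAlgebraic E y ↔ ∃ g : K[X], g ≠ 0 ∧ (∀ n : ℕ, g.eval (n : K) ∈ E) ∧ g.eval y = 0 := by
  constructor
  · rintro ⟨r, hr, hry⟩
    refine ⟨r.map (algebraMap E K), (Polynomial.map_ne_zero_iff (algebraMap E K).injective).2 hr,
      eval_natCast_map_mem E r, ?_⟩
    rwa [eval_map_algebraMap]
  · rintro ⟨g, hg, hE, hgy⟩
    obtain ⟨r, rfl⟩ := exists_map_eq_of_eval_natCast_mem E g hE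
    refine ⟨r, fun h => hg (by simp [h]), ?_⟩
    rwa [eval_map_algebraMap] at hgy

theorem mem_adjoin_insert_iff_exists_eval_natCast_mem (S : Set K) (x z : K) :
    z ∈ IntermediateField.adjoin ℚ (insert x S) ↔
      ∃ g h : K[X], (∀ n : ℕ, g.eval (n : K) ∈ IntermediateField.adjoin ℚ S) ∧
        (∀ n : ℕ, h.eval (n : K) ∈ IntermediateField.adjoin ℚ S) ∧
        h.eval x ≠ 0 ∧ g.eval x = z * h.eval x := by
  have key : z ∈ IntermediateField.adjoin ℚ (insert x S) ↔
      z ∈ IntermediateField.adjoin (IntermediateField.adjoin ℚ S) {x} := by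
    rw [← Set.union_singleton, ← IntermediateField.adjoin_adjoin_left]
    rfl
  rw [key, IntermediateField.mem_adjoin_simple_iff]
  set E := IntermediateField.adjoin ℚ S
  constructor
  · rintro ⟨r, s, rfl⟩
    by_cases hs : aeval x s = 0
    · exact ⟨0, 1, by simp, by simp, by simp, by simp [hs]⟩
    · refine ⟨r.map (algebraMap E K), s.map (algebraMap E K), eval_natCast_map_mem E r,
        eval_natCast_map_mem E s, ?_, ?_⟩
      · rwa [eval_map_algebraMap]
      · rw [eval_map_algebraMap, eval_map_algebraMap, div_mul_cancel₀ _ hs]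
  · rintro ⟨g, h, hg, hh, h0, hz⟩
    obtain ⟨r, rfl⟩ := exists_map_eq_of_eval_natCast_mem E g hg
    obtain ⟨s, rfl⟩ := exists_map_eq_of_eval_natCast_mem E h hh
    rw [eval_map_algebraMap] at h0 hz
    rw [eval_map_algebraMap] at hz
    exact ⟨r, s, by rw [hz, mul_div_cancel_right₀ _ h0]⟩

theorem mem_adjoin_empty_iff (z : K) :
    z ∈ IntermediateField.adjoin ℚ (∅ : Set K) ↔
      ∃ a b c : ℕ, (c : K) ≠ 0 ∧ z * c = a + -(b : K) := by
  rw [IntermediateField.adjoin_empty, IntermediateField.mem_bot]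
  constructor
  · rintro ⟨q, rfl⟩
    refine ⟨q.num.toNat, (-q.num).toNat, q.den, by exact_mod_cast q.den_ne_zero, ?_⟩
    have h1 : ((q * q.den : ℚ) : K) = ((q.num : ℚ) : K) := by rw [Rat.mul_den_eq_num]
    have h2 : ((q.num : ℤ) : K) = (((q.num.toNat : ℤ) - ((-q.num).toNat : ℤ) : ℤ) : K) := by
      congr 1
      omega
    push_cast at h1 h2
    rw [eq_ratCast, h1, h2, sub_eq_add_neg]
  · rintro ⟨a, b, c, hc, h⟩
    refine ⟨((a : ℚ) - b) / c, ?_⟩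
    rw [eq_ratCast]
    push_cast
    rw [div_eq_iff hc, h, sub_eq_add_neg]

theorem trdegQ_le_natCast_iff (n : ℕ) :
    trdegQ K ≤ n ↔ ∃ x : Fin n → K, ∀ y : K,
      IsAlgebraic (IntermediateField.adjoin ℚ (Set.range x)) y := by
  change Algebra.trdeg ℚ K ≤ n ↔ _
  constructor
  · intro h
    obtain ⟨s, hs⟩ := exists_isTranscendenceBasis ℚ K
    rw [← hs.cardinalMk_eq_trdeg] at h
    obtain ⟨x, hx⟩ : ∃ x : Fin n → K, s ⊆ Set.range x := by
      have hfin : s.Finite := Cardinal.lt_aleph0_iff_set_finite.1 (h.trans_lt natCast_lt_aleph0)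
      have hcard : Fintype.card (hfin.toFinset) ≤ Fintype.card (Fin n) := by
        have : s.ncard ≤ n := by
          rw [← Nat.cast_le (α := Cardinal), Set.cast_ncard hfin]
          exact h
        simpa [← Set.ncard_eq_toFinset_card s hfin] using this
      obtain ⟨f⟩ := Function.Embedding.nonempty_of_card_le hcard
      refine ⟨Function.extend f (fun a => (a : K)) 0, fun a ha => ⟨f ⟨a, by simpa using ha⟩, ?_⟩⟩
      rw [f.injective.extend_apply]
    refine ⟨x, fun y => ?_⟩
    have halg := hs.isAlgebraic_field
    rw [Subtype.range_coe] at halg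
    have hle := IntermediateField.adjoin.mono ℚ _ _ hx
    rw [isAlgebraic_iff_exists_eval_natCast_mem]
    obtain ⟨g, hg, hE, hy⟩ :=
      (isAlgebraic_iff_exists_eval_natCast_mem _ y).1 (halg.isAlgebraic y)
    exact ⟨g, hg, fun n => hle (hE n), hy⟩
  · rintro ⟨x, hx⟩
    have halg : Algebra.IsAlgebraic (Algebra.adjoin ℚ (Set.range x)) K :=
      ⟨fun y => IntermediateField.isAlgebraic_adjoin_iff.1 (hx y)⟩
    obtain ⟨t, htx, ht⟩ := exists_isTranscendenceBasis_subset (R := ℚ) (Set.range x)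
    rw [← ht.cardinalMk_eq_trdeg]
    refine (Cardinal.mk_le_mk_of_subset htx).trans ?_
    have h := Cardinal.mk_range_le_lift (f := x)
    simpa using h

end Algebra

/-! ### First-order formulas in the language of rings -/

section Formulas

variable {α : Type}

/-- Weakening of a term by one fresh variable. -/
def weaken (t : Language.ring.Term α) : Language.ring.Term (α ⊕ Unit) := t.relabel Sum.inl

/-- The fresh variable. -/
def fresh : Language.ring.Term (α ⊕ Unit) := Term.var (Sum.inr ())

/-- Existential quantification over the fresh variable. -/
noncomputable def ex (φ : Language.ring.Formula (α ⊕ Unit)) : Language.ring.Formula α :=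
  φ.iExs Unit

/-- Universal quantification over the fresh variable. -/
noncomputable def all (φ : Language.ring.Formula (α ⊕ Unit)) : Language.ring.Formula α :=
  φ.iAlls Unit

/-- `x` is zero or a unit. -/
noncomputable def constF (x : Language.ring.Term α) : Language.ring.Formula α :=
  x.equal 0 ⊔ ex ((weaken x * fresh).equal 1)

/-- `a` divides `b`. -/
noncomputable def dvdF (a b : Language.ring.Term α) : Language.ring.Formula α :=
  ex ((weaken b).equal (weaken a * fresh))

/-- `f` takes the value `b` at `c`, where polynomials are read in the variable `s`. -/
noncomputable def evalF (s f c b : Language.ring.Term α) : Language.ring.Formula α :=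
  dvdF (s + -c) (f + -b)

/-- `s` is a polynomial of degree one. -/
noncomputable def linearF (s : Language.ring.Term α) : Language.ring.Formula α :=
  ∼(constF s) ⊓ all (ex (constF fresh ⊓ evalF (weaken (weaken s)) (weaken fresh) 0 fresh))

/-- `z` is a natural number: some nonzero polynomial vanishes at zero and at `a + 1` for
each of its roots `a ≠ z`. -/
noncomputable def natF (s z : Language.ring.Term α) : Language.ring.Formula α :=
  constF z ⊓ ex (∼(fresh.equal 0) ⊓ evalF (weaken s) fresh 0 0 ⊓
    all (constF fresh ⟹ evalF (weaken (weaken s)) (weaken fresh) fresh 0 ⟹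
      (fresh.equal (weaken (weaken z)) ⊔
        evalF (weaken (weaken s)) (weaken fresh) (fresh + 1) 0)))

/-- The values of `f` at all natural numbers satisfy `φ`. -/
noncomputable def natValuesF (s f : Language.ring.Term α)
    (φ : Language.ring.Formula ((α ⊕ Unit) ⊕ Unit)) : Language.ring.Formula α :=
  all (natF (weaken s) fresh ⟹
    ex (φ ⊓ evalF (weaken (weaken s)) (weaken (weaken f)) (weaken fresh) fresh))

/-- `z` lies in the subfield generated by the first `k` terms of the sequence `x`. -/
noncomputable def fieldF : ℕ → ∀ {α : Type}, Language.ring.Term α → (ℕ → Language.ring.Term α) →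
    Language.ring.Term α → Language.ring.Formula α
  | 0, _, s, _, z => ex (ex (ex
      (natF (weaken (weaken (weaken s))) (weaken (weaken fresh)) ⊓
        natF (weaken (weaken (weaken s))) (weaken fresh) ⊓
        natF (weaken (weaken (weaken s))) fresh ⊓ ∼(fresh.equal 0) ⊓
        (weaken (weaken (weaken z)) * fresh).equal
          (weaken (weaken fresh) + -weaken fresh))))
  | k + 1, _, s, x, z => constF z ⊓ ex (ex (ex
      (constF fresh ⊓ ∼(fresh.equal 0) ⊓
        natValuesF (weaken (weaken (weaken s))) (weaken (weaken fresh))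
          (fieldF k (weaken (weaken (weaken (weaken (weaken s)))))
            (fun i => weaken (weaken (weaken (weaken (weaken (x i)))))) fresh) ⊓
        natValuesF (weaken (weaken (weaken s))) (weaken fresh)
          (fieldF k (weaken (weaken (weaken (weaken (weaken s)))))
            (fun i => weaken (weaken (weaken (weaken (weaken (x i)))))) fresh) ⊓
        evalF (weaken (weaken (weaken s))) (weaken fresh) (weaken (weaken (weaken (x k)))) fresh ⊓
        evalF (weaken (weaken (weaken s))) (weaken (weaken fresh)) (weaken (weaken (weaken (x k))))
          (weaken (weaken (weaken z)) * fresh))))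

/-- `y` is algebraic over the subfield generated by the first `k` terms of the sequence `x`. -/
noncomputable def algebraicF (k : ℕ) (s : Language.ring.Term α) (x : ℕ → Language.ring.Term α)
    (y : Language.ring.Term α) : Language.ring.Formula α :=
  ex (∼(fresh.equal 0) ⊓
    natValuesF (weaken s) fresh
      (fieldF k (weaken (weaken (weaken s))) (fun i => weaken (weaken (weaken (x i)))) fresh) ⊓
    evalF (weaken s) fresh (weaken y) 0)

/-- The field of constants is algebraic over a subfield generated by `n` elements. -/
noncomputable def trdegLeSentence (n : ℕ) : Language.ring.Sentence :=
  let x : ℕ → Language.ring.Term (Empty ⊕ Fin (n + 1)) :=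
    fun i => Term.var (Sum.inr (Fin.ofNat (n + 1) i))
  Formula.iExs (Fin (n + 1)) (linearF (x n) ⊓ (Formula.iInf fun i : Fin n => constF (x i)) ⊓
    all (constF fresh ⟹ algebraicF n (weaken (x n)) (fun i => weaken (x i)) fresh))

section Realize

variable {R : Type*} [CommRing R] [CompatibleRing R] (v : α → R)

@[simp]
theorem realize_weaken (t : Language.ring.Term α) (w : Unit → R) :
    (weaken t).realize (Sum.elim v w) = t.realize v := by
  simp [weaken, Term.realize_relabel, Function.comp_def]

@[simp]
theorem realize_fresh (w : Unit → R) :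
    (fresh : Language.ring.Term (α ⊕ Unit)).realize (Sum.elim v w) = w () := rfl

@[simp]
theorem realize_ex (φ : Language.ring.Formula (α ⊕ Unit)) :
    (ex φ).Realize v ↔ ∃ a : R, φ.Realize (Sum.elim v fun _ => a) := by
  rw [ex, Formula.realize_iExs]
  exact ⟨fun ⟨w, h⟩ => ⟨w (), h⟩, fun ⟨a, h⟩ => ⟨_, h⟩⟩

@[simp]
theorem realize_all (φ : Language.ring.Formula (α ⊕ Unit)) :
    (all φ).Realize v ↔ ∀ a : R, φ.Realize (Sum.elim v fun _ => a) := by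
  rw [all, Formula.realize_iAlls]
  exact ⟨fun h a => h _, fun h w => h (w ())⟩

theorem realize_dvdF (a b : Language.ring.Term α) :
    (dvdF a b).Realize v ↔ a.realize v ∣ b.realize v := by
  simp [dvdF, Dvd.dvd]

theorem realize_evalF (s f c b : Language.ring.Term α) :
    (evalF s f c b).Realize v ↔ s.realize v - c.realize v ∣ f.realize v - b.realize v := by
  simp [evalF, realize_dvdF, sub_eq_add_neg]

end Realize

end Formulas

section Semantics

variable {α : Type} {K : Type*} [Field K] [CompatibleRing K[X]]

theorem realize_constF (x : Language.ring.Term α) (v : α → K[X]) :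
    (constF x).Realize v ↔ ∃ c : K, x.realize v = C c := by
  simp only [constF, Formula.realize_sup, Formula.realize_equal, realize_zero, realize_ex,
    realize_mul, realize_weaken, realize_fresh, realize_one]
  constructor
  · rintro (h | ⟨y, h⟩)
    · exact ⟨0, by simp [h]⟩
    · obtain ⟨c, -, hc⟩ := isUnit_iff.1 (IsUnit.of_mul_eq_one y h)
      exact ⟨c, hc.symm⟩
  · rintro ⟨c, h⟩
    by_cases hc : c = 0
    · exact Or.inl (by simp [h, hc])
    · exact Or.inr ⟨C c⁻¹, by rw [h, ← C_mul, mul_inv_cancel₀ hc, C_1]⟩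

theorem realize_linearF (s : Language.ring.Term α) (v : α → K[X]) :
    (linearF s).Realize v ↔ ∃ e : K[X] ≃ₐ[K] K[X], e (s.realize v) = X := by
  simp only [linearF, Formula.realize_inf, Formula.realize_not, realize_constF, realize_all,
    realize_ex, realize_evalF, realize_weaken, realize_fresh, realize_zero, sub_zero]
  constructor
  · rintro ⟨hs, h⟩
    obtain ⟨_, ⟨c, rfl⟩, hc⟩ := h X
    have hdeg : (s.realize v).natDegree ≤ 1 := by
      simpa using natDegree_le_of_dvd hc (X_sub_C_ne_zero c)
    obtain ⟨a, b, hab⟩ := exists_eq_X_add_C_of_natDegree_le_one hdeg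
    have ha : a ≠ 0 := fun h => hs ⟨b, by simp [hab, h]⟩
    let := invertibleOfNonzero ha
    refine ⟨(algEquivCMulXAddC a b).symm, ?_⟩
    rw [AlgEquiv.symm_apply_eq, hab]
    simp
  · rintro ⟨e, he⟩
    refine ⟨fun ⟨c, hc⟩ => ?_, fun f => ⟨C ((e f).eval 0), ⟨_, rfl⟩, ?_⟩⟩
    · rw [hc, ← algebraMap_eq, e.commutes, algebraMap_eq] at he
      exact X_ne_C c he.symm
    · rw [← map_dvd_iff e, he, map_sub, ← algebraMap_eq, e.commutes, algebraMap_eq,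
        X_dvd_iff, coeff_zero_eq_eval_zero]
      simp

variable {v : α → K[X]} {s : Language.ring.Term α} {e : K[X] ≃ₐ[K] K[X]}

theorem realize_evalF_iff (he : e (s.realize v) = X) {f c b : Language.ring.Term α} {c' b' : K}
    (hc : c.realize v = C c') (hb : b.realize v = C b') :
    (evalF s f c b).Realize v ↔ (e (f.realize v)).eval c' = b' := by
  rw [realize_evalF, ← map_dvd_iff e, map_sub, map_sub, he, hc, hb, ← algebraMap_eq, e.commutes,
    e.commutes, algebraMap_eq, dvd_iff_isRoot]
  simp [sub_eq_zero]

variable [CharZero K]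

theorem realize_natF (he : e (s.realize v) = X) (z : Language.ring.Term α) :
    (natF s z).Realize v ↔ ∃ n : ℕ, z.realize v = C (n : K) := by
  have key : (natF s z).Realize v ↔ ∃ c : K, z.realize v = C c ∧ ∃ p : K[X], p ≠ 0 ∧
      p.eval 0 = 0 ∧ ∀ a : K, p.eval a = 0 → a = c ∨ p.eval (a + 1) = 0 := by
    rw [natF, Formula.realize_inf, realize_constF, ← exists_and_right]
    refine exists_congr fun c => and_congr_right fun hc => ?_
    rw [realize_ex, ← e.symm.toEquiv.exists_congr_right]
    refine exists_congr fun f => ?_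
    rw [Formula.realize_inf, Formula.realize_inf, realize_all, Formula.realize_not,
      Formula.realize_equal, realize_evalF_iff (e := e) (by simpa using he) (c' := 0) (b' := 0)
      (by simp) (by simp), and_assoc]
    refine and_congr (by simp) (and_congr (by simp) ⟨fun h a ha => ?_, fun h x => ?_⟩)
    · have h := h (C a)
      rw [Formula.realize_imp, Formula.realize_imp, Formula.realize_sup, realize_constF,
        realize_evalF_iff (e := e) (by simpa using he) (c' := a) (b' := 0) (by simp) (by simp),
        realize_evalF_iff (e := e) (by simpa using he) (c' := a + 1) (b' := 0) (by simp) (by simp)]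
        at h
      simpa [hc] using h ⟨a, by simp⟩ (by simpa using ha)
    · rw [Formula.realize_imp, Formula.realize_imp, Formula.realize_sup, realize_constF]
      rintro ⟨a, ha⟩
      have ha : x = C a := by simpa using ha
      subst ha
      rw [realize_evalF_iff (e := e) (by simpa using he) (c' := a) (b' := 0) (by simp) (by simp),
        realize_evalF_iff (e := e) (by simpa using he) (c' := a + 1) (b' := 0) (by simp) (by simp)]
      simpa [hc] using h a
  rw [key]
  constructor
  · rintro ⟨c, hc, p, hp, h0, h⟩
    by_contra! hn
    refine hp (eq_zero_of_infinite_isRoot p ((Set.infinite_range_of_injective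
      (Nat.cast_injective (R := K))).mono ?_))
    rintro _ ⟨n, rfl⟩
    change p.eval (n : K) = 0
    induction n with
    | zero => simpa using h0
    | succ n ih =>
      rw [Nat.cast_succ]
      exact (h _ ih).resolve_left fun hnc => hn n (by rw [hc, hnc])
  · rintro ⟨n, hn⟩
    refine ⟨n, hn, ∏ i ∈ Finset.range (n + 1), (X - C (i : K)),
      Finset.prod_ne_zero_iff.2 fun i _ => X_sub_C_ne_zero _, ?_, fun a ha => ?_⟩
    · rw [eval_prod]
      exact Finset.prod_eq_zero (Finset.mem_range.2 n.succ_pos) (by simp)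
    · rw [eval_prod, Finset.prod_eq_zero_iff] at ha
      obtain ⟨i, hi, ha⟩ := ha
      have ha : a = i := by simpa [sub_eq_zero] using ha
      subst ha
      rcases (Nat.lt_succ_iff.1 (Finset.mem_range.1 hi)).eq_or_lt with rfl | hin
      · exact Or.inl rfl
      · right
        rw [eval_prod]
        exact Finset.prod_eq_zero (Finset.mem_range.2 (Nat.succ_lt_succ hin)) (by simp)

theorem realize_natValuesF (he : e (s.realize v) = X) (f : Language.ring.Term α)
    (φ : Language.ring.Formula ((α ⊕ Unit) ⊕ Unit)) (E : Set K)
    (hφ : ∀ a b : K[X], φ.Realize (Sum.elim (Sum.elim v fun _ => a) fun _ => b) ↔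
      ∃ c ∈ E, b = C c) :
    (natValuesF s f φ).Realize v ↔ ∀ n : ℕ, (e (f.realize v)).eval (n : K) ∈ E := by
  rw [natValuesF, realize_all]
  have hnat (a : K[X]) := realize_natF (s := weaken s) (v := Sum.elim v fun _ : Unit => a)
    (e := e) (by simpa using he) fresh
  simp only [Formula.realize_imp, hnat, realize_ex, Formula.realize_inf, hφ, realize_fresh]
  constructor
  · intro h n
    obtain ⟨_, ⟨c, hc, rfl⟩, h⟩ := h _ ⟨n, rfl⟩
    rw [realize_evalF_iff (e := e) (by simpa using he) (c' := n) (b' := c) (by simp) (by simp)] at h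
    simp only [realize_weaken] at h
    rwa [h]
  · rintro h _ ⟨n, rfl⟩
    refine ⟨_, ⟨_, h n, rfl⟩, ?_⟩
    rw [realize_evalF_iff (e := e) (by simpa using he) (c' := n) (by simp) (by simp; rfl)]
    simp

theorem realize_fieldF (k : ℕ) {α : Type} {v : α → K[X]} {s : Language.ring.Term α}
    (he : e (s.realize v) = X) {x : ℕ → Language.ring.Term α} {ξ : ℕ → K}
    (hx : ∀ i < k, (x i).realize v = C (ξ i)) (z : Language.ring.Term α) :
    (fieldF k s x z).Realize v ↔
      ∃ c ∈ IntermediateField.adjoin ℚ (Set.image ξ (Set.Iio k)), z.realize v = C c := by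
  induction k generalizing α with
  | zero =>
    have h0 : Set.image ξ (Set.Iio 0) = ∅ := by simp
    simp only [fieldF, realize_ex, Formula.realize_inf, h0, mem_adjoin_empty_iff]
    have hnat (a b c : K[X]) (t) := realize_natF (s := weaken (weaken (weaken s)))
      (v := Sum.elim (Sum.elim (Sum.elim v fun _ : Unit => a) fun _ : Unit => b)
        fun _ : Unit => c) (e := e) (by simpa using he) t
    simp only [hnat, Formula.realize_not, Formula.realize_equal, realize_mul, realize_add,
      realize_neg, realize_weaken, realize_fresh, realize_zero]
    constructor
    · rintro ⟨_, _, _, ⟨⟨⟨⟨a, rfl⟩, b, rfl⟩, c, rfl⟩, hc⟩, h⟩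
      have hc : (c : K) ≠ 0 := fun h => hc (by rw [h, C_0])
      refine ⟨((a : K) - b) / c, ⟨a, b, c, hc, ?_⟩, ?_⟩
      · rw [div_mul_cancel₀ _ hc, sub_eq_add_neg]
      · refine mul_right_cancel₀ (C_ne_zero.2 hc) ?_
        rw [h, ← C_mul, div_mul_cancel₀ _ hc, C_sub, sub_eq_add_neg]
    · rintro ⟨z', ⟨a, b, c, hc, h⟩, hz⟩
      refine ⟨_, _, _, ⟨⟨⟨⟨a, rfl⟩, b, rfl⟩, c, rfl⟩, C_ne_zero.2 hc⟩, ?_⟩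
      rw [hz, ← C_mul, h, C_add, C_neg]
  | succ k ih =>
    have hins : Set.image ξ (Set.Iio (k + 1)) = insert (ξ k) (Set.image ξ (Set.Iio k)) := by
      rw [← Set.image_insert_eq]
      congr 1
      ext i
      simp [le_iff_eq_or_lt]
    rw [fieldF, Formula.realize_inf, realize_constF, ← exists_and_right]
    refine exists_congr fun z' => ?_
    rw [and_comm (a := z' ∈ _)]
    refine and_congr_right fun hz => ?_
    rw [hins, mem_adjoin_insert_iff_exists_eval_natCast_mem, realize_ex,
      ← e.symm.toEquiv.exists_congr_right]
    refine exists_congr fun g => ?_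
    rw [realize_ex, ← e.symm.toEquiv.exists_congr_right]
    refine exists_congr fun h => ?_
    have hx_lt : ∀ i < k, (x i).realize v = C (ξ i) := fun i hi => hx i (hi.trans k.lt_succ_self)
    have hxk := hx k k.lt_succ_self
    have hee (f : K[X]) : e (e.symm.toEquiv f) = f := e.apply_symm_apply f
    have hval (g h w : K[X]) (t) := realize_natValuesF (s := weaken (weaken (weaken s)))
      (v := Sum.elim (Sum.elim (Sum.elim v fun _ : Unit => g) fun _ : Unit => h)
        fun _ : Unit => w) (e := e) (by simpa using he) t
      (fieldF k (weaken (weaken (weaken (weaken (weaken s)))))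
        (fun i => weaken (weaken (weaken (weaken (weaken (x i)))))) fresh) _
      (fun a b => ih (by simpa using he) (by simpa using hx_lt) fresh)
    simp only [realize_ex, Formula.realize_inf, hval, realize_constF, Formula.realize_not,
      Formula.realize_equal, realize_weaken, realize_fresh, realize_zero, hee]
    constructor
    · rintro ⟨_, ⟨⟨⟨⟨⟨w, rfl⟩, hw⟩, hg⟩, hh⟩, h1⟩, h2⟩
      rw [realize_evalF_iff (e := e) (by simpa using he) (c' := ξ k) (b' := w)
        (by simpa using hxk) (by simp)] at h1
      rw [realize_evalF_iff (e := e) (by simpa using he) (c' := ξ k) (b' := z' * w)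
        (by simpa using hxk) (by simp [hz])] at h2
      simp only [realize_weaken, realize_fresh, hee] at h1 h2
      refine ⟨hg, hh, ?_, ?_⟩
      · exact fun h => hw (by rw [← h1, h, C_0])
      · rw [h2, h1]
    · rintro ⟨hg, hh, hne, heq⟩
      refine ⟨_, ⟨⟨⟨⟨⟨_, rfl⟩, C_ne_zero.2 hne⟩, hg⟩, hh⟩, ?_⟩, ?_⟩
      · rw [realize_evalF_iff (e := e) (by simpa using he) (c' := ξ k)
          (by simpa using hxk) rfl]
        simp
      · rw [realize_evalF_iff (e := e) (by simpa using he) (c' := ξ k) (b' := z' * h.eval (ξ k))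
          (by simpa using hxk) (by simp [hz])]
        simpa using heq

theorem realize_algebraicF (k : ℕ) (he : e (s.realize v) = X) {x : ℕ → Language.ring.Term α}
    {ξ : ℕ → K} (hx : ∀ i < k, (x i).realize v = C (ξ i)) {y : Language.ring.Term α} {y' : K}
    (hy : y.realize v = C y') :
    (algebraicF k s x y).Realize v ↔
      IsAlgebraic (IntermediateField.adjoin ℚ (Set.image ξ (Set.Iio k))) y' := by
  rw [isAlgebraic_iff_exists_eval_natCast_mem, algebraicF, realize_ex,
    ← e.symm.toEquiv.exists_congr_right]
  refine exists_congr fun g => ?_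
  rw [Formula.realize_inf, Formula.realize_inf, realize_evalF_iff (e := e) (by simpa using he)
    (c' := y') (b' := 0) (by simpa using hy) (by simp), realize_natValuesF (e := e)
    (by simpa using he) _ _ _
    (fun a b => realize_fieldF k (e := e) (by simpa using he) (by simpa using hx) fresh), and_assoc]
  simp

end Semantics

theorem realize_trdegLeSentence (K : Type*) [Field K] [CharZero K] [CompatibleRing K[X]] (n : ℕ) :
    K[X] ⊨ trdegLeSentence n ↔ trdegQ K ≤ n := by
  rw [trdegQ_le_natCast_iff, Sentence.Realize, trdegLeSentence, Formula.realize_iExs]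
  simp only [Formula.realize_inf, realize_linearF, Formula.realize_iInf, realize_constF,
    realize_all, Formula.realize_imp]
  have hrange (x : Fin n → K) :
      Set.image (fun i => if h : i < n then x ⟨i, h⟩ else 0) (Set.Iio n) = Set.range x := by
    ext a
    constructor
    · rintro ⟨i, hi, rfl⟩
      have hi : i < n := hi
      exact ⟨⟨i, hi⟩, by simp [hi]⟩
    · rintro ⟨i, rfl⟩
      exact ⟨i, i.2, dif_pos i.2⟩
  constructor
  · rintro ⟨w, ⟨⟨e, he⟩, hx⟩, h⟩
    choose x hx using hx
    refine ⟨x, fun y => ?_⟩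
    have h := h (C y) ⟨y, by simp⟩
    rwa [realize_algebraicF n (e := e) (ξ := fun i => if h : i < n then x ⟨i, h⟩ else 0)
      (by simpa using he) (fun i hi => by simpa [hi] using hx ⟨i, hi⟩) (y' := y) (by simp),
      hrange] at h
  · rintro ⟨x, hx⟩
    have hcast (i : ℕ) (hi : i < n) : Fin.ofNat (n + 1) i = Fin.castSucc ⟨i, hi⟩ := by
      ext
      simpa using hi.trans n.lt_succ_self
    refine ⟨Fin.snoc (fun i => C (x i)) X, ⟨⟨AlgEquiv.refl, ?_⟩, fun i => ⟨x i, ?_⟩⟩, ?_⟩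
    · simp
    · simp
    · rintro _ ⟨y, hy⟩
      rw [realize_algebraicF n (e := AlgEquiv.refl)
        (ξ := fun i => if h : i < n then x ⟨i, h⟩ else 0) (by simp)
        (fun i hi => by simp [-Fin.ofNat_eq_cast, -Fin.castSucc_mk, hi, hcast i hi]) hy, hrange]
      exact hx y

end PolynomialRingFormula

/-- For infinite fields `K₁`, `K₂` of characteristic zero, if the polynomial rings
`K₁[t]` and `K₂[t]` are elementarily equivalent as rings, then the transcendence
degrees of `K₁` and `K₂` over `ℚ` are either both infinite, or both finite and equal. -/
theorem polynomial_elementarilyEquivalent_implies_trdeg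
    (K₁ K₂ : Type u) [Field K₁] [Field K₂] [Infinite K₁] [Infinite K₂]
    [CharZero K₁] [CharZero K₂] :
    letI := compatibleRingOfRing K₁[X]
    letI := compatibleRingOfRing K₂[X]
    (K₁[X] ≅[Language.ring] K₂[X]) →
      ((ℵ₀ ≤ trdegQ K₁ ∧ ℵ₀ ≤ trdegQ K₂) ∨
        (trdegQ K₁ < ℵ₀ ∧ trdegQ K₂ < ℵ₀ ∧ trdegQ K₁ = trdegQ K₂)) := by
  intro h
  let := compatibleRingOfRing K₁[X]
  let := compatibleRingOfRing K₂[X]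
  have key (n : ℕ) : trdegQ K₁ ≤ n ↔ trdegQ K₂ ≤ n := by
    rw [← PolynomialRingFormula.realize_trdegLeSentence,
      ← PolynomialRingFormula.realize_trdegLeSentence]
    exact elementarilyEquivalent_iff.1 h _
  rcases lt_or_ge (trdegQ K₁) ℵ₀ with h₁ | h₁
  · right
    obtain ⟨m, hm⟩ := Cardinal.lt_aleph0.1 h₁
    have h₂ := (key m).1 hm.le
    obtain ⟨k, hk⟩ := Cardinal.lt_aleph0.1 (h₂.trans_lt natCast_lt_aleph0)
    refine ⟨h₁, h₂.trans_lt natCast_lt_aleph0, le_antisymm ?_ (hm ▸ h₂)⟩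
    rw [hk]
    exact (key k).2 hk.le
  · left
    refine ⟨h₁, le_of_not_gt fun h₂ => ?_⟩
    obtain ⟨k, hk⟩ := Cardinal.lt_aleph0.1 h₂
    exact absurd (((key k).2 hk.le).trans_lt natCast_lt_aleph0) (not_lt.2 h₁)
end

section
/- Let K₁ and K₂ be algebraically closed fields of characteristic zero whose transcendence degrees over ℚ are either both infinite, or both finite and equal. Then the Laurent polynomial rings K₁[t,t⁻¹] and K₂[t,t⁻¹] are elementarily equivalent as rings. -/
open FirstOrder Language FirstOrder.Ring LaurentPolynomial Cardinal

universe u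

theorem IsTranscendenceBasis.exists_algEquiv_apply_eq {F L ι : Type*} [Field F] [Field L]
    [Algebra F L] [IsAlgClosed L] {v : ι → L} (hv : IsTranscendenceBasis F v)
    (π : Equiv.Perm ι) : ∃ σ : L ≃ₐ[F] L, ∀ i, σ (v i) = v (π i) := by
  have := IsAlgClosed.isAlgClosure_of_transcendence_basis v hv
  let e : Algebra.adjoin F (Set.range v) ≃ₐ[F] Algebra.adjoin F (Set.range v) :=
    hv.1.aevalEquiv.symm.trans ((MvPolynomial.renameEquiv F π).trans hv.1.aevalEquiv)
  have he (i : ι) : e ⟨v i, Algebra.subset_adjoin ⟨i, rfl⟩⟩ =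
      ⟨v (π i), Algebra.subset_adjoin ⟨π i, rfl⟩⟩ := by
    have (j : ι) : hv.1.aevalEquiv (MvPolynomial.X j) =
        ⟨v j, Algebra.subset_adjoin ⟨j, rfl⟩⟩ := Subtype.ext (by simp)
    simp [e, ← this]
  refine ⟨AlgEquiv.ofRingEquiv (f := IsAlgClosure.equivOfEquiv L L e.toRingEquiv) fun a ↦ ?_,
    fun i ↦ ?_⟩
  · rw [IsScalarTower.algebraMap_apply F (Algebra.adjoin F (Set.range v)) L,
      IsAlgClosure.equivOfEquiv_algebraMap]
    exact congrArg _ (e.commutes a)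
  · exact (IsAlgClosure.equivOfEquiv_algebraMap L L e.toRingEquiv _).trans
      (congrArg Subtype.val (he i))

theorem exists_perm_mapsTo_of_infinite {α : Type*} {s t : Set α} (hs : s.Infinite)
    (ht : t.Finite) : ∃ π : Equiv.Perm α, Set.MapsTo π t s := by
  have := ht.to_subtype
  have := hs.to_subtype
  let f : t ↪ s := (Finite.equivFin t).toEmbedding.trans
    (Fin.valEmbedding.trans (Infinite.natEmbedding s))
  obtain ⟨π, hπ⟩ := Equiv.Perm.exists_extending_pair (Subtype.val : t → α)
    (fun a ↦ (f a : α)) Subtype.val_injective (Subtype.val_injective.comp f.injective)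
  exact ⟨π, fun a ha ↦ (hπ ⟨a, ha⟩).symm ▸ (f ⟨a, ha⟩).2⟩

/-- If `K` has infinite transcendence degree over `F`, then any finite subset of `L` can be moved
into `K` by an automorphism of `L` over `F`. -/
theorem exists_algEquiv_mapsTo_range_algebraMap {F K L : Type*} [Field F] [Field K] [Field L]
    [Algebra F K] [Algebra K L] [Algebra F L] [IsScalarTower F K L] [IsAlgClosed K]
    [IsAlgClosed L] (h : ℵ₀ ≤ Algebra.trdeg F K) {B : Set L} (hB : B.Finite) :
    ∃ σ : L ≃ₐ[F] L, Set.MapsTo σ B (Set.range (algebraMap K L)) := by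
  obtain ⟨s, hs⟩ := exists_isTranscendenceBasis F K
  have hsinf : s.Infinite := by
    rw [← Set.infinite_coe_iff, ← Cardinal.aleph0_le_mk_iff, hs.cardinalMk_eq_trdeg]
    exact h
  have hind : AlgebraicIndepOn F id (algebraMap K L '' s) :=
    (hs.1.map' (f := IsScalarTower.toAlgHom F K L) (algebraMap K L).injective).to_subtype_range'
      (by ext; simp)
  obtain ⟨t, hst, ht⟩ := exists_isTranscendenceBasis_superset hind
  obtain ⟨u, hut, hu, -, hBu⟩ :=
    (AlgebraicIndependent.matroid F L).exists_subset_finite_closure_of_subset_closure (Y := t) hB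
      (fun b _ ↦ by
        rw [AlgebraicIndependent.matroid_closure_eq]
        have := ht.isAlgebraic.isAlgebraic b
        rwa [Subtype.range_coe] at this)
  obtain ⟨π, hπ⟩ := exists_perm_mapsTo_of_infinite
    (s := ((↑) : t → L) ⁻¹' (algebraMap K L '' s)) (t := ((↑) : t → L) ⁻¹' u)
    ((hsinf.image (algebraMap K L).injective.injOn).preimage (by simpa using hst))
    (hu.preimage Subtype.val_injective.injOn)
  obtain ⟨σ, hσ⟩ := ht.exists_algEquiv_apply_eq π
  refine ⟨σ, fun b hb ↦ ?_⟩
  have hbu := hBu hb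
  rw [AlgebraicIndependent.matroid_closure_eq] at hbu
  have hle : Algebra.adjoin F u ≤ (IsScalarTower.toAlgHom F K L).range.comap (σ : L →ₐ[F] L) := by
    refine Algebra.adjoin_le fun x hx ↦ ?_
    obtain ⟨k, -, hk⟩ := hπ (show (⟨x, hut hx⟩ : t) ∈ _ from hx)
    exact ⟨k, hk.trans (hσ _).symm⟩
  let e := AlgEquiv.ofInjective (IsScalarTower.toAlgHom F K L) (algebraMap K L).injective
  let g : Algebra.adjoin F u →ₐ[F] K := e.symm.toAlgHom.comp
    ((AlgHom.comp (σ : L →ₐ[F] L) (Algebra.adjoin F u).val).codRestrict _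
      fun a ↦ hle (Subtype.prop a))
  have hg (a : Algebra.adjoin F u) : algebraMap K L (g a) = σ a :=
    congrArg Subtype.val (e.apply_symm_apply ⟨σ a, hle a.2⟩)
  have hginj : Function.Injective g := fun a b hab ↦
    Subtype.ext (σ.injective (by rw [← hg, ← hg, hab]))
  have halg : IsAlgebraic K (σ b) :=
    IsAlgebraic.ringHom_of_comp_eq (g : Algebra.adjoin F u →+* K) (σ : L →+* L) hbu hginj
      (RingHom.ext hg)
  exact minpoly.mem_range_of_degree_eq_one K _
    (IsAlgClosed.degree_eq_one_of_irreducible K (minpoly.irreducible halg.isIntegral))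

/-- An injective ring homomorphism is an embedding of structures in the language of rings. -/
def RingHom.toRingLanguageEmbedding {R S : Type*} [Ring R] [Ring S] [CompatibleRing R]
    [CompatibleRing S] (f : R →+* S) (hf : Function.Injective f) : R ↪[Language.ring] S where
  toFun := f
  inj' := hf
  map_fun' g x := by cases g <;> simp
  map_rel' r := by cases r

theorem AddMonoidAlgebra.mapRingHom_injective {R S : Type*} (M : Type*) [Semiring R] [Semiring S]
    [AddMonoid M] {f : R →+* S} (hf : Function.Injective f) :
    Function.Injective (AddMonoidAlgebra.mapRingHom M f) :=
  AddMonoidAlgebra.map_injective f.toAddMonoidHom hf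

theorem AddMonoidAlgebra.mem_range_mapRingHom {R S M : Type*} [Semiring R] [Semiring S]
    [AddMonoid M] {f : R →+* S} {x : AddMonoidAlgebra S M} (h : ∀ m, x.coeff m ∈ Set.range f) :
    x ∈ Set.range (AddMonoidAlgebra.mapRingHom M f) := by
  classical
  choose y hy using h
  refine ⟨.ofCoeff (Finsupp.onFinset x.coeff.support (fun m ↦ if x.coeff m = 0 then 0 else y m)
    fun m hm ↦ by simp at hm; simpa using hm.1), ?_⟩
  ext m
  rw [AddMonoidAlgebra.coeff_mapRingHom]
  by_cases hm : x.coeff m = 0 <;> simp [hm, hy]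

theorem aleph0_le_trdeg_adjoin_of_finite {F K : Type*} [Field F] [Field K] [Algebra F K]
    (h : ℵ₀ ≤ Algebra.trdeg F K) {A : Set K} (hA : A.Finite) :
    ℵ₀ ≤ Algebra.trdeg (IntermediateField.adjoin F A) K := by
  have : Algebra.EssFiniteType F (IntermediateField.adjoin F A) :=
    IntermediateField.essFiniteType_iff.2 (IntermediateField.fg_adjoin_of_finite hA)
  rw [← trdeg_add_eq F (IntermediateField.adjoin F A), aleph0_le_add_iff] at h
  exact h.resolve_left (trdeg_lt_aleph0 F (IntermediateField.adjoin F A)).not_ge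

/-- The Tarski-Vaught test applies to `K[T;T⁻¹] → L[T;T⁻¹]`: a witness over `L` is moved into `K` by
an automorphism of `L` fixing the coefficients of the parameters. -/
theorem elementarilyEquivalent_laurentPolynomial_of_algebra (K L : Type*) [Field K] [Field L]
    [IsAlgClosed K] [IsAlgClosed L] [CharZero K] [Algebra K L] (h : ℵ₀ ≤ Algebra.trdeg ℚ K) :
    letI := compatibleRingOfRing K[T;T⁻¹]
    letI := compatibleRingOfRing L[T;T⁻¹]
    (K[T;T⁻¹] ≅[Language.ring] L[T;T⁻¹]) := by
  let := compatibleRingOfRing K[T;T⁻¹]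
  let := compatibleRingOfRing L[T;T⁻¹]
  let ι : K[T;T⁻¹] ↪[Language.ring] L[T;T⁻¹] :=
    (AddMonoidAlgebra.mapRingHom ℤ (algebraMap K L)).toRingLanguageEmbedding
      (AddMonoidAlgebra.mapRingHom_injective ℤ (algebraMap K L).injective)
  refine (ι.toElementaryEmbedding fun n φ x a hφ ↦ ?_).elementarilyEquivalent
  let A : Set K := ⋃ i, (x i).coeff '' (x i).coeff.support
  let F := IntermediateField.adjoin ℚ A
  have hA : A.Finite := Set.finite_iUnion fun i ↦ (Finset.finite_toSet _).image _
  obtain ⟨σ, hσ⟩ := exists_algEquiv_mapsTo_range_algebraMap (L := L)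
    (aleph0_le_trdeg_adjoin_of_finite h hA)
    ((a.coeff.support.finite_toSet).image a.coeff)
  let σT : L[T;T⁻¹] ≃+* L[T;T⁻¹] := AddMonoidAlgebra.mapRingEquiv ℤ σ.toRingEquiv
  let τ : L[T;T⁻¹] ≃[Language.ring] L[T;T⁻¹] := languageEquivEquivRingEquiv.symm σT
  have hτ (z) (m) : (τ z).coeff m = σ (z.coeff m) :=
    AddMonoidAlgebra.coeff_mapRingEquiv σ.toRingEquiv z m
  obtain ⟨b, hb⟩ := AddMonoidAlgebra.mem_range_mapRingHom (f := algebraMap K L)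
      (x := τ a) fun m ↦ by
    rw [hτ]
    by_cases hm : a.coeff m = 0
    · exact ⟨0, by simp [hm]⟩
    · exact hσ ⟨m, by simpa using hm, rfl⟩
  refine ⟨b, ?_⟩
  have hx (i) : τ (ι (x i)) = ι (x i) := by
    ext m
    rw [hτ]
    change σ ((AddMonoidAlgebra.mapRingHom ℤ (algebraMap K L) (x i)).coeff m) =
      (AddMonoidAlgebra.mapRingHom ℤ (algebraMap K L) (x i)).coeff m
    rw [AddMonoidAlgebra.coeff_mapRingHom]
    by_cases hm : (x i).coeff m = 0
    · simp [hm]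
    · have hmem : (x i).coeff m ∈ F := IntermediateField.subset_adjoin _ _
        (Set.mem_iUnion.2 ⟨i, m, by simpa using hm, rfl⟩)
      exact σ.commutes ⟨_, hmem⟩
  have := (StrongHomClass.realize_boundedFormula τ φ).2 hφ
  rw [Fin.comp_snoc] at this
  convert! this using 2
  exact (funext hx).symm

theorem AlgebraicIndependent.nonempty_ringHom_algebraicClosure_fractionRing {F K ι : Type*}
    [Field F] [Field K] [IsAlgClosed K] [Algebra F K] {x : ι → K} (hx : AlgebraicIndependent F x) :
    Nonempty (AlgebraicClosure (FractionRing (MvPolynomial ι F)) →+* K) := by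
  let f := IsFractionRing.liftAlgHom (K := FractionRing (MvPolynomial ι F))
    (algebraicIndependent_iff_injective_aeval.2 hx)
  let := f.toRingHom.toAlgebra
  exact ⟨(IsAlgClosed.lift : AlgebraicClosure (FractionRing (MvPolynomial ι F)) →ₐ[
    FractionRing (MvPolynomial ι F)] K)⟩

theorem aleph0_le_trdeg_algebraicClosure_fractionRing :
    ℵ₀ ≤ Algebra.trdeg ℚ (AlgebraicClosure (FractionRing (MvPolynomial ℕ ℚ))) := by
  let f : MvPolynomial ℕ ℚ →+* AlgebraicClosure (FractionRing (MvPolynomial ℕ ℚ)) :=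
    (algebraMap (FractionRing (MvPolynomial ℕ ℚ)) _).comp (algebraMap _ _)
  have hf : Function.Injective f.toRatAlgHom :=
    (algebraMap (FractionRing (MvPolynomial ℕ ℚ)) _).injective.comp
      (IsFractionRing.injective (MvPolynomial ℕ ℚ) (FractionRing (MvPolynomial ℕ ℚ)))
  rw [← Cardinal.mk_nat]
  exact ((MvPolynomial.algebraicIndependent_X ℕ ℚ).map' hf).cardinalMk_le_trdeg

theorem elementarilyEquivalent_laurentPolynomial_of_aleph0_le_trdegQ (K : Type*) [Field K]
    [IsAlgClosed K] [CharZero K] (h : ℵ₀ ≤ trdegQ K) :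
    letI := compatibleRingOfRing
      (AlgebraicClosure (FractionRing (MvPolynomial ℕ ℚ)))[T;T⁻¹]
    letI := compatibleRingOfRing K[T;T⁻¹]
    ((AlgebraicClosure (FractionRing (MvPolynomial ℕ ℚ)))[T;T⁻¹] ≅[Language.ring] K[T;T⁻¹]) := by
  obtain ⟨s, hs⟩ := exists_isTranscendenceBasis ℚ K
  have : Infinite s := by
    rw [← Cardinal.aleph0_le_mk_iff, hs.cardinalMk_eq_trdeg]
    exact h
  obtain ⟨f⟩ := (hs.1.comp _ (Infinite.natEmbedding s).injective
    ).nonempty_ringHom_algebraicClosure_fractionRing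
  let := f.toAlgebra
  exact elementarilyEquivalent_laurentPolynomial_of_algebra _ K
    aleph0_le_trdeg_algebraicClosure_fractionRing

/-- For algebraically closed fields `K₁`, `K₂` of characteristic zero whose
transcendence degrees over `ℚ` are either both infinite, or both finite and equal,
the Laurent polynomial rings `K₁[t,t⁻¹]` and `K₂[t,t⁻¹]` are elementarily
equivalent as rings. -/
theorem trdeg_implies_laurent_elementarilyEquivalent
    (K₁ K₂ : Type u) [Field K₁] [Field K₂] [IsAlgClosed K₁] [IsAlgClosed K₂]
    [CharZero K₁] [CharZero K₂]
    (h : (ℵ₀ ≤ trdegQ K₁ ∧ ℵ₀ ≤ trdegQ K₂) ∨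
        (trdegQ K₁ < ℵ₀ ∧ trdegQ K₂ < ℵ₀ ∧ trdegQ K₁ = trdegQ K₂)) :
    letI := compatibleRingOfRing K₁[T;T⁻¹]
    letI := compatibleRingOfRing K₂[T;T⁻¹]
    (K₁[T;T⁻¹] ≅[Language.ring] K₂[T;T⁻¹]) := by
  let := compatibleRingOfRing K₁[T;T⁻¹]
  let := compatibleRingOfRing K₂[T;T⁻¹]
  obtain ⟨h₁, h₂⟩ | ⟨-, -, h⟩ := h
  · let := compatibleRingOfRing (AlgebraicClosure (FractionRing (MvPolynomial ℕ ℚ)))[T;T⁻¹]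
    exact (elementarilyEquivalent_laurentPolynomial_of_aleph0_le_trdegQ K₁ h₁).symm.trans
      (elementarilyEquivalent_laurentPolynomial_of_aleph0_le_trdegQ K₂ h₂)
  · obtain ⟨s, hs⟩ := exists_isTranscendenceBasis ℚ K₁
    obtain ⟨t, ht⟩ := exists_isTranscendenceBasis ℚ K₂
    obtain ⟨e⟩ := Cardinal.eq.1 (hs.cardinalMk_eq_trdeg.trans (h.trans ht.cardinalMk_eq_trdeg.symm))
    let f := languageEquivEquivRingEquiv.symm (AddMonoidAlgebra.mapRingEquiv ℤ
      (IsAlgClosed.equivOfTranscendenceBasis _ _ e hs ht))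
    exact f.toElementaryEmbedding.elementarilyEquivalent
end

section
/- There exist fields K₁ and K₂ that are elementarily equivalent as rings but whose Laurent polynomial rings K₁[t,t⁻¹] and K₂[t,t⁻¹] are not elementarily equivalent as rings. -/
open FirstOrder Language FirstOrder.Ring LaurentPolynomial

namespace LaurentTorsion

/-- For the ring `K[T;T⁻¹]` over an algebraically closed field `K`, this property says that every
nonzero element of `K` is a root of unity: `a` ranges over the nonzero constants, `v` is a
nonconstant unit, and `u ≠ 1` is a unit such that `u - 1` is divisible by `v - 1` and `v - a`. -/
def Property (R : Type*) [CommRing R] : Prop :=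
  ∀ a a' b : R, a * a' = 1 → (a + 1 = 0 ∨ (a + 1) * b = 1) →
    ∃ v v' u u' p q : R, v * v' = 1 ∧ u * u' = 1 ∧ u + -1 = p * (v + -1) ∧
      u + -1 = q * (v + -a) ∧ u ≠ 1 ∧ ∀ w, (v + -1) * w ≠ 1

/-- The equality of two terms, as a formula without free variables of its own. -/
abbrev eqTerm {n : ℕ} (s t : Language.ring.Term (Empty ⊕ Fin n)) :
    Language.ring.BoundedFormula Empty n := s =' t

/-- A first-order sentence expressing `LaurentTorsion.Property`. -/
def sentence : Language.ring.Sentence :=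
  ∀' ∀' ∀' (eqTerm (&0 * &1) 1 ⟹ (eqTerm (&0 + 1) 0 ⊔ eqTerm ((&0 + 1) * &2) 1) ⟹
    ∃' ∃' ∃' ∃' ∃' ∃' (eqTerm (&3 * &4) 1 ⊓ (eqTerm (&5 * &6) 1 ⊓
      (eqTerm (&5 + -1) (&7 * (&3 + -1)) ⊓ (eqTerm (&5 + -1) (&8 * (&3 + -&0)) ⊓
      (∼(eqTerm &5 1) ⊓ ∀' ∼(eqTerm ((&3 + -1) * &9) 1)))))))

theorem realize_sentence (R : Type*) [CommRing R] [CompatibleRing R] :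
    R ⊨ sentence ↔ Property R := by
  simp [Sentence.Realize, Formula.Realize, sentence, Property, Fin.snoc]

theorem exists_eq_C_mul_T_of_isUnit {K : Type*} [Field K] {f : K[T;T⁻¹]} (hf : IsUnit f) :
    ∃ (c : K) (n : ℤ), c ≠ 0 ∧ f = C c * T n := by
  obtain ⟨g, hg⟩ := hf.exists_right_inv
  obtain ⟨n, p, hp⟩ := exists_T_pow f
  obtain ⟨m, q, hq⟩ := exists_T_pow g
  have hpq : p * q = Polynomial.X ^ (n + m) := by
    apply Polynomial.toLaurent_injective
    rw [map_mul, hp, hq, Polynomial.toLaurent_X_pow, Nat.cast_add, T_add]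
    linear_combination (T (n : ℤ) * T (m : ℤ)) * hg
  obtain ⟨i, -, hi⟩ := (dvd_prime_pow Polynomial.prime_X _).1 (Dvd.intro _ hpq)
  obtain ⟨e, he⟩ := hi.symm
  obtain ⟨c, hc, hce⟩ := Polynomial.isUnit_iff.1 e.isUnit
  refine ⟨c, i - n, hc.ne_zero, ?_⟩
  rw [T_sub, ← mul_assoc, ← Polynomial.toLaurent_C, ← Polynomial.toLaurent_X_pow,
    ← map_mul, hce, mul_comm (e : Polynomial K), he, hp, mul_T_assoc]
  simp

theorem coeff_C_mul_T {K : Type*} [Field K] (c : K) (n m : ℤ) :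
    (C c * T n).coeff m = if n = m then c else 0 := by
  rw [← single_eq_C_mul_T, AddMonoidAlgebra.coeff_single, Finsupp.single_apply]

theorem exists_eq_C {K : Type*} [Field K] {f : K[T;T⁻¹]} (hf : IsUnit f)
    (h : f + 1 = 0 ∨ IsUnit (f + 1)) : ∃ c : K, c ≠ 0 ∧ f = C c := by
  obtain ⟨c, n, hc, rfl⟩ := exists_eq_C_mul_T_of_isUnit hf
  suffices n = 0 from ⟨c, hc, by simp [this]⟩
  by_contra hn
  obtain ⟨d, m, h⟩ : ∃ (d : K) (m : ℤ), C c * T n + C 1 * T 0 = C d * T m := by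
    rcases h with h | h
    · exact ⟨0, 0, by simpa using h⟩
    · obtain ⟨d, m, -, h⟩ := exists_eq_C_mul_T_of_isUnit h
      exact ⟨d, m, by simpa using h⟩
  have h0 := congrArg (fun g => g.coeff 0) h
  have hn' := congrArg (fun g => g.coeff n) h
  simp only [AddMonoidAlgebra.coeff_add, Finsupp.add_apply, coeff_C_mul_T] at h0 hn'
  grind

theorem exists_pow_eq_one {p : ℕ} [Fact p.Prime] {K : Type*} [Field K] [Algebra (ZMod p) K]
    [Algebra.IsAlgebraic (ZMod p) K] {c : K} (hc : c ≠ 0) : ∃ n, 0 < n ∧ c ^ n = 1 := by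
  have hi : IsIntegral (ZMod p) c := Algebra.IsIntegral.isIntegral c
  let L := IntermediateField.adjoin (ZMod p) {c}
  have : FiniteDimensional (ZMod p) L := IntermediateField.adjoin.finiteDimensional hi
  have : Finite L := Module.finite_of_finite (ZMod p)
  let x : L := ⟨c, IntermediateField.mem_adjoin_simple_self _ _⟩
  have hx : x ≠ 0 := fun h => hc (congrArg Subtype.val h)
  obtain ⟨n, hn, h⟩ := isOfFinOrder_iff_pow_eq_one.1 (isOfFinOrder_of_finite (Units.mk0 x hx))
  exact ⟨n, hn, congrArg (fun y : Lˣ => ((y : L) : K)) h⟩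

theorem property_of_torsion {K : Type*} [Field K]
    (hK : ∀ c : K, c ≠ 0 → ∃ n, 0 < n ∧ c ^ n = 1) : Property K[T;T⁻¹] := by
  intro a a' b ha hb
  obtain ⟨c, hc, rfl⟩ := exists_eq_C (IsUnit.of_mul_eq_one _ ha)
    (hb.imp_right fun h => IsUnit.of_mul_eq_one _ h)
  obtain ⟨n, hn, hcn⟩ := hK c hc
  obtain ⟨p, hp⟩ := sub_dvd_pow_sub_pow (T 1 : K[T;T⁻¹]) 1 n
  obtain ⟨q, hq⟩ := sub_dvd_pow_sub_pow (T 1 : K[T;T⁻¹]) (C c) n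
  rw [T_pow, mul_one, one_pow] at hp
  rw [T_pow, mul_one, ← map_pow, hcn, map_one] at hq
  refine ⟨T 1, T (-1), T n, T (-n), p, q, ?_, ?_, ?_, ?_, ?_, ?_⟩
  · rw [← T_add, add_neg_cancel, T_zero]
  · rw [← T_add, add_neg_cancel, T_zero]
  · rw [← sub_eq_add_neg, hp, sub_eq_add_neg, mul_comm]
  · rw [← sub_eq_add_neg, hq, sub_eq_add_neg, mul_comm]
  · intro h
    have := congrArg (fun g => g.coeff 0) ((T_zero (R := K)).symm ▸ h)
    simp [hn.ne'] at this
  · intro w h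
    simpa using congrArg (eval₂ (RingHom.id K) 1) h

theorem exists_zpow_eq {K : Type*} [Field K] [IsAlgClosed K] (b : Kˣ) {k : ℤ} (hk : k ≠ 0) :
    ∃ s : Kˣ, s ^ k = b := by
  have key (b : Kˣ) : ∃ s : Kˣ, s ^ k.natAbs = b := by
    obtain ⟨z, hz⟩ := IsAlgClosed.exists_pow_nat_eq (b : K) (Int.natAbs_pos.2 hk)
    have hz0 : z ≠ 0 := by
      rintro rfl
      rw [zero_pow (Int.natAbs_ne_zero.2 hk)] at hz
      exact b.ne_zero hz.symm
    exact ⟨Units.mk0 z hz0, Units.ext (by simpa using hz)⟩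
  rcases Int.natAbs_eq k with h | h
  · obtain ⟨s, hs⟩ := key b
    exact ⟨s, by rw [h, zpow_natCast, hs]⟩
  · obtain ⟨s, hs⟩ := key b⁻¹
    exact ⟨s, by rw [h, zpow_neg, zpow_natCast, hs, inv_inv]⟩

theorem torsion_of_property {K : Type*} [Field K] [IsAlgClosed K] (h : Property K[T;T⁻¹])
    (a : Kˣ) : ∃ n, 0 < n ∧ a ^ n = 1 := by
  obtain ⟨v, v', u, u', p, q, hv, hu, hp, hq, hu1, hw⟩ :=
    h (C a) (C (a⁻¹ : Kˣ)) (C (a + 1 : K)⁻¹) (by simp [← map_mul]) (by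
      by_cases h0 : (a + 1 : K) = 0
      · left
        rw [← map_one C, ← map_add, h0, map_zero]
      · right
        rw [← map_one C, ← map_add, ← map_mul, mul_inv_cancel₀ h0])
  obtain ⟨c, k, hc, rfl⟩ := exists_eq_C_mul_T_of_isUnit (IsUnit.of_mul_eq_one _ hv)
  obtain ⟨d, m, hd, rfl⟩ := exists_eq_C_mul_T_of_isUnit (IsUnit.of_mul_eq_one _ hu)
  lift c to Kˣ using hc.isUnit
  lift d to Kˣ using hd.isUnit
  have hk : k ≠ 0 := by
    rintro rfl
    by_cases hc1 : (c : K) + -1 = 0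
    · apply hu1
      have : (C (c : K) * T 0 + -1 : K[T;T⁻¹]) = 0 := by
        rw [T_zero, mul_one, ← map_one C, ← map_neg, ← map_add, hc1, map_zero]
      rw [this, mul_zero] at hp
      linear_combination hp
    · apply hw (C (c + -1 : K)⁻¹)
      rw [T_zero, mul_one, ← map_one C, ← map_neg, ← map_add, ← map_mul, mul_inv_cancel₀ hc1]
  have eval_u {r : K} {g : K[T;T⁻¹]} {s : Kˣ} (hs : (c : K) * (s ^ k : Kˣ) = r)
      (hg : C (d : K) * T m + -1 = g * (C (c : K) * T k + -C r)) : d * s ^ m = 1 := by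
    have := congrArg (eval₂ (RingHom.id K) s) hg
    rw [map_mul, map_add, map_add, map_neg, map_neg, map_one, eval₂_C_mul_T, eval₂_C_mul_T,
      eval₂_C, RingHom.id_apply, RingHom.id_apply, RingHom.id_apply, hs, add_neg_cancel,
      mul_zero] at this
    apply Units.ext
    push_cast at this ⊢
    linear_combination this
  obtain ⟨s, hs⟩ := exists_zpow_eq c⁻¹ hk
  obtain ⟨s', hs'⟩ := exists_zpow_eq (c⁻¹ * a) hk
  have h1 : d * s ^ m = 1 := eval_u (r := 1) (by rw [hs, Units.mul_inv])
    (by rw [map_one C]; exact hp)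
  have h2 : d * s' ^ m = 1 := eval_u (r := a) (by rw [hs', ← Units.val_mul, mul_inv_cancel_left]) hq
  have ham : a ^ m = 1 := by
    have : a = (s' / s) ^ k := by rw [div_zpow, hs, hs', mul_div_cancel_left]
    rw [this, zpow_comm, div_zpow, mul_left_cancel (h2.trans h1.symm), div_self', one_zpow]
  have hm : m ≠ 0 := by
    rintro rfl
    apply hu1
    rw [zpow_zero, mul_one] at h1
    simp [h1]
  exact ⟨m.natAbs, Int.natAbs_pos.2 hm, pow_natAbs_eq_one.2 ham⟩

theorem elementarilyEquivalent_of_isAlgClosed (p : ℕ) [Fact p.Prime] (K L : Type) [Field K]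
    [Field L] [IsAlgClosed K] [IsAlgClosed L] [CharP K p] [CharP L p] [CompatibleRing K]
    [CompatibleRing L] : K ≅[Language.ring] L :=
  Theory.IsComplete.models_elementarily_equivalent
    (Field.ACF_isComplete (Or.inl (Fact.out : p.Prime))) K L

end LaurentTorsion

open LaurentTorsion in
/-- There exist fields `K₁` and `K₂` that are elementarily equivalent as rings, but
whose Laurent polynomial rings `K₁[t,t⁻¹]` and `K₂[t,t⁻¹]` are not elementarily
equivalent as rings. -/
theorem exists_fields_elementarilyEquivalent_laurent_not :
    ∃ (K₁ K₂ : Type) (_ : Field K₁) (_ : Field K₂),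
      (letI := compatibleRingOfRing K₁
       letI := compatibleRingOfRing K₂
       (K₁ ≅[Language.ring] K₂)) ∧
      (letI := compatibleRingOfRing K₁[T;T⁻¹]
       letI := compatibleRingOfRing K₂[T;T⁻¹]
       ¬ (K₁[T;T⁻¹] ≅[Language.ring] K₂[T;T⁻¹])) := by
  let F := RatFunc (ZMod 2)
  have : CharP F 2 := charP_of_injective_algebraMap (algebraMap (ZMod 2) F).injective 2
  have : CharP (AlgebraicClosure F) 2 :=
    charP_of_injective_algebraMap (algebraMap F (AlgebraicClosure F)).injective 2
  have : CharP (AlgebraicClosure (ZMod 2)) 2 :=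
    charP_of_injective_algebraMap (algebraMap (ZMod 2) (AlgebraicClosure (ZMod 2))).injective 2
  refine ⟨AlgebraicClosure (ZMod 2), AlgebraicClosure F, inferInstance, inferInstance, ?_, ?_⟩
  · let := compatibleRingOfRing (AlgebraicClosure (ZMod 2))
    let := compatibleRingOfRing (AlgebraicClosure F)
    exact elementarilyEquivalent_of_isAlgClosed 2 _ _
  · let := compatibleRingOfRing (AlgebraicClosure (ZMod 2))[T;T⁻¹]
    let := compatibleRingOfRing (AlgebraicClosure F)[T;T⁻¹]
    intro h
    have hP : Property (AlgebraicClosure F)[T;T⁻¹] :=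
      (realize_sentence _).1 ((elementarilyEquivalent_iff.1 h _).1 ((realize_sentence _).2
        (property_of_torsion fun _ => exists_pow_eq_one (p := 2))))
    have hX : algebraMap F (AlgebraicClosure F) RatFunc.X ≠ 0 := by
      simpa using RatFunc.X_ne_zero
    obtain ⟨n, hn, hXn⟩ := torsion_of_property hP (Units.mk0 _ hX)
    have hXn : algebraMap F (AlgebraicClosure F) (RatFunc.X ^ n) = algebraMap F _ 1 := by
      simpa using congrArg Units.val hXn
    replace hXn := (algebraMap F (AlgebraicClosure F)).injective hXn
    rw [← RatFunc.algebraMap_X, ← map_pow, ← map_one (algebraMap (Polynomial (ZMod 2)) _)] at hXn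
    have := congrArg Polynomial.natDegree (RatFunc.algebraMap_injective _ hXn)
    rw [Polynomial.natDegree_X_pow, Polynomial.natDegree_one] at this
    exact hn.ne' this
end

section
/- There exist fields K₁ and K₂ that are elementarily equivalent as rings but whose polynomial rings K₁[t] and K₂[t] are not elementarily equivalent as rings. -/
open FirstOrder Language FirstOrder.Ring Polynomial

namespace FirstOrder.Ring

universe u

variable {α : Type u} {n : ℕ}

/-- View a term in `n` bound variables as a term in `n + 1` bound variables. -/
def weaken (s : Language.ring.Term (α ⊕ Fin n)) : Language.ring.Term (α ⊕ Fin (n + 1)) :=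
  s.relabel (Sum.map id Fin.castSucc)

/-- The formula expressing that `s` divides `t`. -/
def dvdFormula (s t : Language.ring.Term (α ⊕ Fin n)) : Language.ring.BoundedFormula α n :=
  ∃' ((weaken t) =' (weaken s * &(Fin.last n)))

/-- The formula expressing that every divisor of `f` is a unit or divisible by `t`, and that
`f` is congruent to `1` modulo `t - 1`. -/
def powFormula (t f : Language.ring.Term (α ⊕ Fin n)) : Language.ring.BoundedFormula α n :=
  (∀' (dvdFormula (&(Fin.last n)) (weaken f) ⟹
    (dvdFormula (&(Fin.last n)) 1 ⊔ dvdFormula (weaken t) (&(Fin.last n))))) ⊓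
  dvdFormula (t + -1) (f + -1)

/-- The sentence expressing that for some nonzero nonunit `t`, every unit is a ratio of integers,
where the integer `n` is represented by the residue of `t ^ n - 1` modulo `(t - 1) ^ 2`. -/
def ratioSentence : Language.ring.Sentence :=
  ∃' (∼(&0 =' 0) ⊓ (∼(dvdFormula (&0) 1) ⊓ ∀' (dvdFormula (&1) 1 ⟹ ∃' ∃' ∃'
    (powFormula (&0) (&2) ⊓ (powFormula (&0) (&3) ⊓ (powFormula (&0) (&4) ⊓
      (dvdFormula ((&0 + -1) * (&0 + -1)) (&1 * (&2 + -1) + (&3 + -(&4))) ⊓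
        ∼(dvdFormula ((&0 + -1) * (&0 + -1)) (&2 + -1)))))))))

section Realize

variable {R : Type*} [CommRing R] [CompatibleRing R]

@[simp]
theorem realize_weaken (s : Language.ring.Term (α ⊕ Fin n)) (v : α → R) (xs : Fin n → R) (a : R) :
    (weaken s).realize (Sum.elim v (Fin.snoc xs a)) = s.realize (Sum.elim v xs) := by
  rw [weaken, Term.realize_relabel]
  congr 1
  ext (i | i) <;> simp

@[simp]
theorem realize_dvdFormula (s t : Language.ring.Term (α ⊕ Fin n)) (v : α → R) (xs : Fin n → R) :
    (dvdFormula s t).Realize v xs ↔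
      s.realize (Sum.elim v xs) ∣ t.realize (Sum.elim v xs) := by
  simp [dvdFormula, dvd_def]

/-- Every divisor of `f` is a unit or divisible by `t`, and `f` is congruent to `1`
modulo `t - 1`. In a polynomial ring over a field this forces `f` to be a power of `t`. -/
def IsPowLike (t f : R) : Prop :=
  (∀ d, d ∣ f → IsUnit d ∨ t ∣ d) ∧ t - 1 ∣ f - 1

@[simp]
theorem realize_powFormula (s t : Language.ring.Term (α ⊕ Fin n)) (v : α → R) (xs : Fin n → R) :
    (powFormula s t).Realize v xs ↔
      IsPowLike (s.realize (Sum.elim v xs)) (t.realize (Sum.elim v xs)) := by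
  simp [powFormula, IsPowLike, isUnit_iff_dvd_one, sub_eq_add_neg]

theorem realize_ratioSentence :
    R ⊨ ratioSentence ↔ ∃ t : R, t ≠ 0 ∧ ¬ IsUnit t ∧ ∀ x : R, IsUnit x → ∃ f g h : R,
      IsPowLike t f ∧ IsPowLike t g ∧ IsPowLike t h ∧
        (t - 1) ^ 2 ∣ x * (f - 1) + (g - h) ∧ ¬ (t - 1) ^ 2 ∣ f - 1 := by
  simp [ratioSentence, Sentence.Realize, Formula.Realize, Fin.snoc, isUnit_iff_dvd_one,
    sub_eq_add_neg, pow_two]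

end Realize

theorem sq_sub_one_dvd_pow_sub_one_sub {R : Type*} [CommRing R] (t : R) (n : ℕ) :
    (t - 1) ^ 2 ∣ t ^ n - 1 - n * (t - 1) := by
  induction n with
  | zero => simp
  | succ n ih =>
    obtain ⟨c, hc⟩ := ih
    exact ⟨t * c + n, by push_cast; linear_combination t * hc⟩

theorem sq_sub_one_dvd_iff {R : Type*} [CommRing R] [IsDomain R] {t : R} (ht : t - 1 ≠ 0) (x : R)
    (a b c : ℕ) :
    (t - 1) ^ 2 ∣ x * (t ^ a - 1) + (t ^ b - t ^ c) ↔ t - 1 ∣ x * a + (b - c) := by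
  have h : (t - 1) ^ 2 ∣ x * (t ^ a - 1) + (t ^ b - t ^ c) - (t - 1) * (x * a + (b - c)) := by
    obtain ⟨u, hu⟩ := sq_sub_one_dvd_pow_sub_one_sub t a
    obtain ⟨v, hv⟩ := sq_sub_one_dvd_pow_sub_one_sub t b
    obtain ⟨w, hw⟩ := sq_sub_one_dvd_pow_sub_one_sub t c
    exact ⟨x * u + v - w, by linear_combination x * hu + hv - hw⟩
  rw [dvd_iff_dvd_of_dvd_sub h, pow_two, mul_dvd_mul_iff_left ht]

theorem sq_sub_one_dvd_pow_sub_one_iff {R : Type*} [CommRing R] [IsDomain R] {t : R}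
    (ht : t - 1 ≠ 0) (a : ℕ) : (t - 1) ^ 2 ∣ t ^ a - 1 ↔ t - 1 ∣ (a : R) := by
  simpa using sq_sub_one_dvd_iff ht 1 a 0 0

section Polynomial

variable {K : Type*} [Field K]

theorem isPowLike_X_pow (n : ℕ) : IsPowLike (X : K[X]) (X ^ n) := by
  refine ⟨fun d hd ↦ ?_, sub_one_dvd_pow_sub_one X n⟩
  obtain ⟨i, -, hi⟩ := (dvd_prime_pow prime_X n).1 hd
  rcases i.eq_zero_or_pos with rfl | hpos
  · exact .inl (by simpa using hi)
  · exact .inr ((dvd_pow_self X hpos.ne').trans hi.symm.dvd)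

theorem natDegree_sub_one_pos {t : K[X]} (h0 : t ≠ 0) (hu : ¬ IsUnit t) :
    0 < (t - 1).natDegree := by
  rw [← C_1, natDegree_sub_C]
  exact natDegree_pos_iff_degree_pos.2 (degree_pos_of_ne_zero_of_nonunit h0 hu)

theorem eq_zero_of_sub_one_dvd_C {t : K[X]} (h0 : t ≠ 0) (hu : ¬ IsUnit t) {c : K}
    (h : t - 1 ∣ C c) : c = 0 := by
  by_contra hc
  have := natDegree_le_of_dvd h (C_ne_zero.2 hc)
  have := natDegree_sub_one_pos h0 hu
  simp_all

theorem IsPowLike.exists_eq_pow {t f : K[X]} (h0 : t ≠ 0) (hu : ¬ IsUnit t)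
    (h : IsPowLike t f) : ∃ n : ℕ, f = t ^ n := by
  have hf : f ≠ 0 := by
    rintro rfl
    have : t - 1 ∣ C (-1 : K) := by simpa using h.2
    simpa using eq_zero_of_sub_one_dvd_C h0 hu this
  obtain ⟨g, hg, hfg⟩ :=
    (FiniteMultiplicity.of_not_isUnit hu hf).exists_eq_pow_mul_and_not_dvd
  set n := multiplicity t f
  have hgu : IsUnit g := (h.1 g (hg ▸ dvd_mul_left _ _)).resolve_right hfg
  obtain ⟨c, -, rfl⟩ := isUnit_iff.1 hgu
  have hc : t - 1 ∣ C (c - 1) := by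
    have key : (C (c - 1) : K[X]) = (f - 1) - C c * (t ^ n - 1) := by
      rw [hg, C_sub, C_1]; ring
    rw [key]
    exact dvd_sub h.2 ((sub_one_dvd_pow_sub_one t n).mul_left _)
  have : c = 1 := sub_eq_zero.1 (eq_zero_of_sub_one_dvd_C h0 hu hc)
  exact ⟨n, by simp [hg, this]⟩

theorem realize_ratioSentence_rat [CompatibleRing ℚ[X]] : ℚ[X] ⊨ ratioSentence := by
  rw [realize_ratioSentence]
  have hX : (X - 1 : ℚ[X]) ≠ 0 := X_sub_C_ne_zero 1
  refine ⟨X, X_ne_zero, not_isUnit_X, fun x hx ↦ ?_⟩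
  obtain ⟨q, -, rfl⟩ := isUnit_iff.1 hx
  refine ⟨X ^ q.den, X ^ (-q.num).toNat, X ^ q.num.toNat, isPowLike_X_pow _, isPowLike_X_pow _,
    isPowLike_X_pow _, ?_, ?_⟩
  · rw [sq_sub_one_dvd_iff hX]
    have h : q * q.den + (((-q.num).toNat : ℚ) - (q.num.toNat : ℚ)) = 0 := by
      rw [Rat.mul_den_eq_num]
      have : q.num + ((-q.num).toNat - q.num.toNat : ℤ) = 0 := by omega
      exact_mod_cast this
    have := congrArg C h
    simp only [C_add, C_mul, C_sub, C_eq_natCast, C_0] at this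
    rw [this]
    exact dvd_zero _
  · rw [sq_sub_one_dvd_pow_sub_one_iff hX, ← C_eq_natCast]
    exact fun h ↦ q.den_ne_zero <| by
      exact_mod_cast eq_zero_of_sub_one_dvd_C X_ne_zero not_isUnit_X h

theorem countable_of_realize_ratioSentence [CompatibleRing K[X]] (h : K[X] ⊨ ratioSentence) :
    Countable K := by
  rw [realize_ratioSentence] at h
  obtain ⟨t, h0, hu, h⟩ := h
  have ht : t - 1 ≠ 0 := ne_zero_of_natDegree_gt (natDegree_sub_one_pos h0 hu)
  have key (x : K) : ∃ p : ℕ × ℕ × ℕ, ((p.2.2 : K) - p.2.1) / p.1 = x := by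
    rcases eq_or_ne x 0 with rfl | hx
    · exact ⟨0, by simp⟩
    obtain ⟨f, g, k, hf, hg, hk, hdvd, hndvd⟩ := h (C x) (isUnit_C.2 hx.isUnit)
    obtain ⟨a, rfl⟩ := hf.exists_eq_pow h0 hu
    obtain ⟨b, rfl⟩ := hg.exists_eq_pow h0 hu
    obtain ⟨c, rfl⟩ := hk.exists_eq_pow h0 hu
    rw [sq_sub_one_dvd_iff ht] at hdvd
    rw [sq_sub_one_dvd_pow_sub_one_iff ht] at hndvd
    have ha : (a : K) ≠ 0 := fun ha ↦ hndvd (by simp [← C_eq_natCast, ha])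
    have hx : x * a + (b - c) = 0 := eq_zero_of_sub_one_dvd_C h0 hu (by simpa using hdvd)
    refine ⟨(a, b, c), ?_⟩
    rw [div_eq_iff ha]
    linear_combination -hx
  exact Function.Surjective.countable key

end Polynomial

theorem elementarilyEquivalent_of_ringEquiv {R S : Type*} [NonAssocRing R] [NonAssocRing S]
    [CompatibleRing R] [CompatibleRing S] (e : R ≃+* S) : R ≅[Language.ring] S :=
  StrongHomClass.elementarilyEquivalent (languageEquivEquivRingEquiv.symm e)

theorem exists_uncountable_field_elementarilyEquivalent (k : Type) [Field k] [Infinite k]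
    [CompatibleRing k] : ∃ (K : Type) (_ : Field K), Uncountable K ∧
      (letI := compatibleRingOfRing K
       (k ≅[Language.ring] K)) := by
  obtain ⟨N, hN, hcard⟩ := exists_elementarilyEquivalent_card_eq Language.ring k
    Cardinal.continuum.{0} Cardinal.aleph0_le_continuum (by
      simpa using (Cardinal.natCast_lt_aleph0 (n := 5)).le.trans Cardinal.aleph0_le_continuum)
  have : Theory.field.Model N := hN.theory_model
  let := Field.fieldOfModelField N
  let c := Field.compatibleRingOfModelField N
  refine ⟨N, inferInstance, ?_, ?_⟩
  · rw [← Cardinal.aleph0_lt_mk_iff, hcard]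
    exact Cardinal.aleph0_lt_continuum
  · exact Eq.trans hN (@elementarilyEquivalent_of_ringEquiv N N _ _ c (compatibleRingOfRing N)
      (RingEquiv.refl N))

end FirstOrder.Ring

/-- There exist fields `K₁` and `K₂` that are elementarily equivalent as rings, but
whose polynomial rings `K₁[t]` and `K₂[t]` are not elementarily equivalent as rings. -/
theorem exists_fields_elementarilyEquivalent_polynomial_not :
    ∃ (K₁ K₂ : Type) (_ : Field K₁) (_ : Field K₂),
      (letI := compatibleRingOfRing K₁
       letI := compatibleRingOfRing K₂
       (K₁ ≅[Language.ring] K₂)) ∧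
      (letI := compatibleRingOfRing K₁[X]
       letI := compatibleRingOfRing K₂[X]
       ¬ (K₁[X] ≅[Language.ring] K₂[X])) := by
  let := compatibleRingOfRing ℚ
  obtain ⟨K, _, hK, hequiv⟩ := exists_uncountable_field_elementarilyEquivalent ℚ
  refine ⟨ℚ, K, inferInstance, inferInstance, hequiv, ?_⟩
  let := compatibleRingOfRing ℚ[X]
  let := compatibleRingOfRing K[X]
  intro h
  exact not_countable_iff.2 hK (countable_of_realize_ratioSentence
    ((h.realize_sentence ratioSentence).1 realize_ratioSentence_rat))
end
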